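/- arXiv:1410.4079 — 2 statements merged into one kernel-verified Lean document; each statement's English description precedes it below -/
import Mathlib

section
/- There exist constants ŝ₀ > 0, θ̂₀ > 0 and γ > 0, depending only on a, p, n, μ, such that the following holds: for every θ ≥ θ̂₀ and every function w : ℝⁿ × [s₀, ∞) → ℝ of class C² in y and C¹ in s which solves equation (W) and is such that w, ∇w and ∂_s w are bounded on ℝⁿ × [s₁, s₂] for all s₀ ≤ s₁ < s₂, one has for all s₂ > s₁ ≥ max{ŝ₀, s₀}: J_a[w](s₂) - J_a[w](s₁) ≤ -(1/2) ∫_{s₁}^{s₂} ∫_{ℝⁿ} (∂_s w(y,s))² ρ(y) dy ds. -/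
open MeasureTheory Real Filter Topology

noncomputable def hfun (p a μ : ℝ) (z : ℝ) : ℝ :=
  μ * |z| ^ (p - 1) * z / (Real.log (2 + z ^ 2)) ^ a

noncomputable def Hfun (p a μ : ℝ) (z : ℝ) : ℝ :=
  ∫ ξ in (0:ℝ)..z, hfun p a μ ξ

noncomputable def rho (n : ℕ) (y : EuclideanSpace ℝ (Fin n)) : ℝ :=
  (4 * Real.pi) ^ (-(n : ℝ) / 2) * Real.exp (-‖y‖ ^ 2 / 4)

/-- The Laplacian of `f`, written as the sum of second derivatives in the coordinate
directions. -/
noncomputable def lap (n : ℕ) (f : EuclideanSpace ℝ (Fin n) → ℝ)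
    (y : EuclideanSpace ℝ (Fin n)) : ℝ :=
  ∑ i : Fin n, fderiv ℝ (fun z => fderiv ℝ f z (EuclideanSpace.single i 1)) y
      (EuclideanSpace.single i 1)

/-- `w` is a classical solution of equation (W):
`∂ₛ w = Δw - (y/2)·∇w - w/(p-1) + |w|^(p-1) w + e^(-ps/(p-1)) h(e^(s/(p-1)) w)`,
of class `C²` in `y` and `C¹` in `s`, on `ℝⁿ × [s₀, ∞)`. -/
def SolvesW (n : ℕ) (p a μ s₀ : ℝ) (w : EuclideanSpace ℝ (Fin n) → ℝ → ℝ) : Prop :=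
  (∀ s, s₀ ≤ s → ContDiff ℝ 2 (fun y => w y s)) ∧
  (∀ y, ∀ s, s₀ ≤ s → DifferentiableAt ℝ (fun s' => w y s') s) ∧
  (∀ y, ∀ s, s₀ ≤ s →
    deriv (fun s' => w y s') s =
      lap n (fun z => w z s) y - (1 / 2) * fderiv ℝ (fun z => w z s) y y
        - w y s / (p - 1) + |w y s| ^ (p - 1) * w y s
        + Real.exp (-p * s / (p - 1)) * hfun p a μ (Real.exp (s / (p - 1)) * w y s))

/-- `w`, `∇w` and `∂ₛ w` are bounded on `ℝⁿ × [s₁, s₂]` for all `s₀ ≤ s₁ < s₂`. -/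
def BoundedW (n : ℕ) (s₀ : ℝ) (w : EuclideanSpace ℝ (Fin n) → ℝ → ℝ) : Prop :=
  ∀ s₁ s₂ : ℝ, s₀ ≤ s₁ → s₁ < s₂ → ∃ M : ℝ, ∀ y, ∀ s ∈ Set.Icc s₁ s₂,
    |w y s| ≤ M ∧ ‖fderiv ℝ (fun z => w z s) y‖ ≤ M ∧ |deriv (fun s' => w y s') s| ≤ M

noncomputable def Enat0 (n : ℕ) (p : ℝ) (w : EuclideanSpace ℝ (Fin n) → ℝ → ℝ) (s : ℝ) : ℝ :=
  ∫ y, ((1 / 2) * ‖fderiv ℝ (fun z => w z s) y‖ ^ 2 + (w y s) ^ 2 / (2 * (p - 1))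
      - |w y s| ^ (p + 1) / (p + 1)) * rho n y

noncomputable def Ipert (n : ℕ) (p a μ : ℝ) (w : EuclideanSpace ℝ (Fin n) → ℝ → ℝ)
    (s : ℝ) : ℝ :=
  -Real.exp (-(p + 1) * s / (p - 1)) *
    ∫ y, Hfun p a μ (Real.exp (s / (p - 1)) * w y s) * rho n y

noncomputable def Etot (n : ℕ) (p a μ : ℝ) (w : EuclideanSpace ℝ (Fin n) → ℝ → ℝ)
    (s : ℝ) : ℝ :=
  Enat0 n p w s + Ipert n p a μ w s

/-- The Lyapunov functional `J_a[w](s) = E[w](s) e^((γ/a) s^(-a)) + θ s^(-a)`. -/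
noncomputable def Jfun (n : ℕ) (p a μ γ θ : ℝ) (w : EuclideanSpace ℝ (Fin n) → ℝ → ℝ)
    (s : ℝ) : ℝ :=
  Etot n p a μ w s * Real.exp ((γ / a) * s ^ (-a)) + θ * s ^ (-a)

/-- On Euclidean space, the divergence of an integrable `C¹` vector field has zero integral as soon
as it is integrable. -/
theorem integral_divergence_eq_zero {n : ℕ} (V : Fin n → EuclideanSpace ℝ (Fin n) → ℝ)
    (hV : ∀ i, ContDiff ℝ 1 (V i)) (hint : ∀ i, Integrable (V i))
    (hdiv : Integrable fun y => ∑ i, fderiv ℝ (V i) y (EuclideanSpace.single i 1)) :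
    ∫ y, ∑ i, fderiv ℝ (V i) y (EuclideanSpace.single i 1) = 0 := by
  set χ : ContDiffBump (0 : EuclideanSpace ℝ (Fin n)) := ⟨1, 2, one_pos, one_lt_two⟩ with hχ
  set c : ℕ → ℝ := fun k => ((k : ℝ) + 1)⁻¹ with hc
  have hcpos : ∀ k, 0 < c k := fun k => by simp only [hc]; positivity
  have hclim : Tendsto c atTop (𝓝 0) := by
    simpa [hc, one_div] using tendsto_one_div_add_atTop_nhds_zero_nat (𝕜 := ℝ)
  set X : ℕ → EuclideanSpace ℝ (Fin n) → ℝ := fun k y => χ (c k • y) with hX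
  have hχs : ContDiff ℝ 1 (fun y => χ y) := χ.contDiff
  have hXs : ∀ k, ContDiff ℝ 1 (X k) := fun k => hχs.comp (contDiff_const_smul (c k))
  have hXc : ∀ k, HasCompactSupport (X k) := fun k =>
    χ.hasCompactSupport.comp_smul (hcpos k).ne'
  obtain ⟨C, hC⟩ := (χ.hasCompactSupport.fderiv (𝕜 := ℝ)).exists_bound_of_continuous
    (hχs.continuous_fderiv one_ne_zero)
  have hXd : ∀ k y i, |fderiv ℝ (X k) y (EuclideanSpace.single i 1)| ≤ c k * C := by
    intro k y i
    have h1 : fderiv ℝ (X k) y = c k • fderiv ℝ (fun z => χ z) (c k • y) := by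
      simp only [hX]
      exact fderiv_comp_smul (c k)
    have h2 := (fderiv ℝ (X k) y).le_opNorm (EuclideanSpace.single i (1:ℝ))
    have h3 : ‖fderiv ℝ (X k) y‖ ≤ c k * C := by
      rw [h1, norm_smul, Real.norm_of_nonneg (hcpos k).le]
      exact mul_le_mul_of_nonneg_left (hC _) (hcpos k).le
    rw [← Real.norm_eq_abs]
    simpa using h2.trans (mul_le_mul_of_nonneg_right h3 (norm_nonneg _))
  have hdc : ∀ i, Continuous fun y => fderiv ℝ (V i) y (EuclideanSpace.single i 1) := fun i =>
    ((hV i).continuous_fderiv one_ne_zero).clm_apply continuous_const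
  have hXdc : ∀ k (i : Fin n), Continuous fun y => fderiv ℝ (X k) y (EuclideanSpace.single i 1) :=
    fun k i => ((hXs k).continuous_fderiv one_ne_zero).clm_apply continuous_const
  have hI1 : ∀ k i, Integrable fun y => X k y * fderiv ℝ (V i) y (EuclideanSpace.single i 1) :=
    fun k i => ((hXs k).continuous.mul (hdc i)).integrable_of_hasCompactSupport (hXc k).mul_right
  have hI2 : ∀ k i, Integrable fun y => fderiv ℝ (X k) y (EuclideanSpace.single i 1) * V i y :=
    fun k i => (hint i).bdd_mul (c := c k * C) (hXdc k i).aestronglyMeasurable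
      (Eventually.of_forall fun y => hXd k y i)
  have hI3 : ∀ k i, Integrable fun y => X k y * V i y :=
    fun k i => ((hXs k).continuous.mul (hV i).continuous).integrable_of_hasCompactSupport
      (hXc k).mul_right
  have hparts : ∀ k, ∫ y, X k y * ∑ i, fderiv ℝ (V i) y (EuclideanSpace.single i 1) =
      -∫ y, ∑ i, fderiv ℝ (X k) y (EuclideanSpace.single i 1) * V i y := by
    intro k
    simp_rw [Finset.mul_sum]
    rw [integral_finsetSum _ fun i _ => hI1 k i, integral_finsetSum _ fun i _ => hI2 k i,
      ← Finset.sum_neg_distrib]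
    refine Finset.sum_congr rfl fun i _ => ?_
    exact integral_mul_fderiv_eq_neg_fderiv_mul_of_integrable (hI2 k i) (hI1 k i) (hI3 k i)
      (fun y _ => (hXs k).differentiable one_ne_zero y)
      (fun y _ => (hV i).differentiable one_ne_zero y)
  have hl1 : Tendsto (fun k => ∫ y, X k y * ∑ i, fderiv ℝ (V i) y (EuclideanSpace.single i 1))
      atTop (𝓝 (∫ y, ∑ i, fderiv ℝ (V i) y (EuclideanSpace.single i 1))) := by
    refine tendsto_integral_of_dominated_convergence _ (fun k => ?_) hdiv.norm (fun k => ?_) ?_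
    · exact ((hXs k).continuous.mul
        (continuous_finsetSum _ fun i _ => hdc i)).aestronglyMeasurable
    · refine Eventually.of_forall fun y => ?_
      rw [norm_mul]
      refine mul_le_of_le_one_left (norm_nonneg _) ?_
      rw [Real.norm_of_nonneg χ.nonneg]
      exact χ.le_one
    · refine Eventually.of_forall fun y => ?_
      have : Tendsto (fun k => X k y) atTop (𝓝 1) := by
        have h0 : Tendsto (fun k => c k • y) atTop (𝓝 0) := by
          simpa using hclim.smul_const y
        have h1 := (hχs.continuous.tendsto 0).comp h0
        have h2 : χ (0 : EuclideanSpace ℝ (Fin n)) = 1 :=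
          χ.one_of_mem_closedBall (by simp [hχ])
        rwa [h2] at h1
      simpa using this.mul_const _
  have hl2 : Tendsto (fun k => -∫ y, ∑ i, fderiv ℝ (X k) y (EuclideanSpace.single i 1) * V i y)
      atTop (𝓝 0) := by
    have hsum : Integrable fun y => ∑ i, |V i y| := integrable_finsetSum _ fun i _ => (hint i).abs
    refine squeeze_zero_norm (a := fun k => c k * C * ∫ y, ∑ i, |V i y|) (fun k => ?_) ?_
    · rw [norm_neg, ← integral_const_mul]
      refine norm_integral_le_of_norm_le (hsum.const_mul _) (Eventually.of_forall fun y => ?_)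
      rw [Finset.mul_sum]
      refine (norm_sum_le _ _).trans (Finset.sum_le_sum fun i _ => ?_)
      rw [norm_mul]
      exact mul_le_mul_of_nonneg_right (hXd k y i) (abs_nonneg _)
    · simpa using (hclim.mul_const C).mul_const (∫ y, ∑ i, |V i y|)
  simp_rw [hparts] at hl1
  exact tendsto_nhds_unique hl1 hl2

theorem rho_pos (n : ℕ) (y : EuclideanSpace ℝ (Fin n)) : 0 < rho n y := by
  unfold rho; positivity

theorem contDiff_rho (n : ℕ) {k : WithTop ℕ∞} : ContDiff ℝ k (rho n) := by
  unfold rho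
  exact contDiff_const.mul (((contDiff_norm_sq ℝ).neg.div_const 4).exp)

theorem fderiv_rho (n : ℕ) (y v : EuclideanSpace ℝ (Fin n)) :
    fderiv ℝ (rho n) y v = -(1 / 2) * inner ℝ y v * rho n y := by
  have h := ((((hasStrictFDerivAt_norm_sq y).hasFDerivAt.neg.mul_const (4⁻¹ : ℝ)).exp).const_mul
    ((4 * Real.pi) ^ (-(n : ℝ) / 2)))
  have h' : HasFDerivAt (rho n) _ y := h
  rw [h'.fderiv]
  simp [rho, div_eq_mul_inv]
  ring

theorem integral_rho (n : ℕ) : ∫ y, rho n y = 1 := by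
  have h := GaussianFourier.integral_rexp_neg_mul_sq_norm (V := EuclideanSpace ℝ (Fin n))
    (b := 1 / 4) (by norm_num)
  have h2 : ∀ y : EuclideanSpace ℝ (Fin n), -‖y‖ ^ 2 / 4 = -(1 / 4) * ‖y‖ ^ 2 := fun y => by ring
  simp only [rho, integral_const_mul, h2, h, finrank_euclideanSpace, Fintype.card_fin]
  rw [show Real.pi / (1 / 4) = 4 * Real.pi by ring, ← Real.rpow_add (by positivity)]
  simp [neg_div]

theorem integrable_rho (n : ℕ) : Integrable (rho n) :=
  Integrable.of_integral_ne_zero (by rw [integral_rho]; exact one_ne_zero)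

theorem integrable_mul_rho {n : ℕ} {f : EuclideanSpace ℝ (Fin n) → ℝ} (hf : Continuous f) {M : ℝ}
    (hM : ∀ y, |f y| ≤ M) : Integrable fun y => f y * rho n y :=
  (integrable_rho n).bdd_mul (c := M) hf.aestronglyMeasurable (Eventually.of_forall hM)

/-- The pointwise inner product of the gradients of `f` and `g`, in coordinates. -/
noncomputable def gradInner (n : ℕ) (f g : EuclideanSpace ℝ (Fin n) → ℝ)
    (y : EuclideanSpace ℝ (Fin n)) : ℝ :=
  ∑ i : Fin n, fderiv ℝ f y (EuclideanSpace.single i 1) * fderiv ℝ g y (EuclideanSpace.single i 1)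

/-- The Ornstein-Uhlenbeck operator `Δ - (y/2)·∇`. -/
noncomputable def ornstein (n : ℕ) (f : EuclideanSpace ℝ (Fin n) → ℝ)
    (y : EuclideanSpace ℝ (Fin n)) : ℝ :=
  lap n f y - (1 / 2) * fderiv ℝ f y y

theorem sum_mul_apply_single {n : ℕ} (L : EuclideanSpace ℝ (Fin n) →L[ℝ] ℝ)
    (v : EuclideanSpace ℝ (Fin n)) : ∑ i, v i * L (EuclideanSpace.single i 1) = L v := by
  conv_rhs => rw [← (EuclideanSpace.basisFun (Fin n) ℝ).sum_repr v]
  simp [map_sum]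

theorem sum_sq_apply_single {n : ℕ} (L : EuclideanSpace ℝ (Fin n) →L[ℝ] ℝ) :
    ∑ i, L (EuclideanSpace.single i 1) * L (EuclideanSpace.single i 1) = ‖L‖ ^ 2 := by
  set g := (InnerProductSpace.toDual ℝ (EuclideanSpace ℝ (Fin n))).symm L with hg
  have h1 : ∀ v, L v = inner ℝ g v := fun v => by
    rw [hg, InnerProductSpace.toDual_symm_apply]
  have h2 : ‖L‖ = ‖g‖ := by rw [hg, LinearIsometryEquiv.norm_map]
  rw [h2, EuclideanSpace.norm_sq_eq]
  refine Finset.sum_congr rfl fun i _ => ?_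
  rw [h1]
  simp [EuclideanSpace.inner_single_right, sq]

theorem gradInner_self {n : ℕ} (f : EuclideanSpace ℝ (Fin n) → ℝ) (y : EuclideanSpace ℝ (Fin n)) :
    gradInner n f f y = ‖fderiv ℝ f y‖ ^ 2 := sum_sq_apply_single _

theorem norm_apply_single_le {n : ℕ} (L : EuclideanSpace ℝ (Fin n) →L[ℝ] ℝ) (i : Fin n) :
    |L (EuclideanSpace.single i 1)| ≤ ‖L‖ := by
  simpa using L.le_opNorm (EuclideanSpace.single i (1:ℝ))

/-- Bounded `C²` functions with bounded gradient and bounded image under the Ornstein-Uhlenbeck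
operator, with a common bound `M`. -/
structure IsTame (n : ℕ) (M : ℝ) (f : EuclideanSpace ℝ (Fin n) → ℝ) : Prop where
  contDiff : ContDiff ℝ 2 f
  abs_le : ∀ y, |f y| ≤ M
  norm_fderiv_le : ∀ y, ‖fderiv ℝ f y‖ ≤ M
  abs_ornstein_le : ∀ y, |ornstein n f y| ≤ M

section Tame

variable {n : ℕ} {M M' : ℝ} {f g : EuclideanSpace ℝ (Fin n) → ℝ}

theorem IsTame.nonneg (hf : IsTame n M f) : 0 ≤ M := (abs_nonneg _).trans (hf.abs_le 0)

theorem IsTame.continuous (hf : IsTame n M f) : Continuous f := hf.contDiff.continuous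

theorem contDiff_fderiv_apply (hf : ContDiff ℝ 2 f) (v : EuclideanSpace ℝ (Fin n)) :
    ContDiff ℝ 1 fun y => fderiv ℝ f y v :=
  (hf.fderiv_right (m := 1) (by norm_num)).clm_apply contDiff_const

theorem continuous_ornstein (hf : ContDiff ℝ 2 f) : Continuous (ornstein n f) := by
  unfold ornstein lap
  refine (continuous_finsetSum _ fun i _ => ?_).sub (continuous_const.mul ?_)
  · exact ((contDiff_fderiv_apply hf _).continuous_fderiv one_ne_zero).clm_apply continuous_const
  · exact (hf.continuous_fderiv two_ne_zero).clm_apply continuous_id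

theorem continuous_gradInner (hf : ContDiff ℝ 2 f) (hg : ContDiff ℝ 2 g) :
    Continuous (gradInner n f g) := by
  unfold gradInner
  exact continuous_finsetSum _ fun i _ => (contDiff_fderiv_apply hf _).continuous.mul
    (contDiff_fderiv_apply hg _).continuous

theorem IsTame.abs_gradInner_le (hf : IsTame n M f) (hg : IsTame n M' g)
    (y : EuclideanSpace ℝ (Fin n)) : |gradInner n f g y| ≤ n * (M * M') := by
  unfold gradInner
  refine (Finset.abs_sum_le_sum_abs _ _).trans ?_
  refine (Finset.sum_le_card_nsmul _ _ (M * M') fun i _ => ?_).trans (by simp)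
  rw [abs_mul]
  exact mul_le_mul ((norm_apply_single_le _ i).trans (hf.norm_fderiv_le y))
    ((norm_apply_single_le _ i).trans (hg.norm_fderiv_le y)) (abs_nonneg _) hf.nonneg

theorem IsTame.integrable_gradInner (hf : IsTame n M f) (hg : IsTame n M' g) :
    Integrable fun y => gradInner n f g y * rho n y :=
  integrable_mul_rho (continuous_gradInner hf.contDiff hg.contDiff) (hf.abs_gradInner_le hg)

theorem IsTame.integrable_mul_ornstein (hf : IsTame n M f) (hg : IsTame n M' g) :
    Integrable fun y => f y * ornstein n g y * rho n y :=
  integrable_mul_rho (M := M * M') (hf.continuous.mul (continuous_ornstein hg.contDiff))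
    fun y => by
      rw [abs_mul]
      exact mul_le_mul (hf.abs_le y) (hg.abs_ornstein_le y) (abs_nonneg _) hf.nonneg

/-- Green's formula for the Ornstein-Uhlenbeck operator. -/
theorem IsTame.integral_mul_ornstein (hf : IsTame n M f) (hg : IsTame n M' g) :
    ∫ y, f y * ornstein n g y * rho n y = -∫ y, gradInner n f g y * rho n y := by
  have hsum : ∀ y, ∑ i, fderiv ℝ
      (fun z => f z * fderiv ℝ g z (EuclideanSpace.single i 1) * rho n z) y
        (EuclideanSpace.single i 1) =
      f y * ornstein n g y * rho n y + gradInner n f g y * rho n y := by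
    intro y
    have hfd : DifferentiableAt ℝ f y := hf.contDiff.differentiable two_ne_zero y
    have hrd : DifferentiableAt ℝ (rho n) y := (contDiff_rho n (k := 1)).differentiable one_ne_zero y
    have hgd : ∀ i : Fin n, DifferentiableAt ℝ
        (fun z => fderiv ℝ g z (EuclideanSpace.single i 1)) y :=
      fun i => (contDiff_fderiv_apply hg.contDiff _).differentiable one_ne_zero y
    have hterm : ∀ i : Fin n, fderiv ℝ
        (fun z => f z * fderiv ℝ g z (EuclideanSpace.single i 1) * rho n z) y
          (EuclideanSpace.single i 1) =
        f y * rho n y * fderiv ℝ (fun z => fderiv ℝ g z (EuclideanSpace.single i 1)) y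
            (EuclideanSpace.single i 1)
          - 1 / 2 * f y * rho n y * (y i * fderiv ℝ g y (EuclideanSpace.single i 1))
          + rho n y * (fderiv ℝ f y (EuclideanSpace.single i 1) *
            fderiv ℝ g y (EuclideanSpace.single i 1)) := by
      intro i
      have hd := ((hfd.hasFDerivAt.mul (hgd i).hasFDerivAt).mul hrd.hasFDerivAt).fderiv
      refine (congrArg (fun L => L (EuclideanSpace.single i 1)) hd).trans ?_
      simp [fderiv_rho, EuclideanSpace.inner_single_right]
      ring
    simp_rw [hterm]
    rw [Finset.sum_add_distrib, Finset.sum_sub_distrib, ← Finset.mul_sum, ← Finset.mul_sum,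
      ← Finset.mul_sum, sum_mul_apply_single]
    simp only [ornstein, lap, gradInner]
    ring
  have hC1 : ∀ i : Fin n, ContDiff ℝ 1
      fun z => f z * fderiv ℝ g z (EuclideanSpace.single i 1) * rho n z := fun i =>
    ((hf.contDiff.of_le one_le_two).mul (contDiff_fderiv_apply hg.contDiff _)).mul (contDiff_rho n)
  have hI := (hf.integrable_mul_ornstein hg).add (hf.integrable_gradInner hg)
  have h := integral_divergence_eq_zero _ hC1
    (fun i => integrable_mul_rho (M := M * M')
      (hf.continuous.mul (contDiff_fderiv_apply hg.contDiff _).continuous) fun y => by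
        rw [abs_mul]
        exact mul_le_mul (hf.abs_le y) ((norm_apply_single_le _ i).trans (hg.norm_fderiv_le y))
          (abs_nonneg _) hf.nonneg)
    (by simp_rw [hsum]; exact hI)
  simp_rw [hsum] at h
  rw [integral_add (hf.integrable_mul_ornstein hg) (hf.integrable_gradInner hg)] at h
  linarith

theorem IsTame.integrable_norm_fderiv_sq (hf : IsTame n M f) :
    Integrable fun y => ‖fderiv ℝ f y‖ ^ 2 * rho n y := by
  simpa only [gradInner_self] using hf.integrable_gradInner hf

theorem IsTame.integral_norm_fderiv_sq (hf : IsTame n M f) :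
    ∫ y, ‖fderiv ℝ f y‖ ^ 2 * rho n y = -∫ y, f y * ornstein n f y * rho n y := by
  rw [hf.integral_mul_ornstein hf, neg_neg]
  simp only [gradInner_self]

/-- Convexity of the Dirichlet energy. -/
theorem IsTame.dirichlet_sub_le (hf : IsTame n M f) (hg : IsTame n M' g) :
    (∫ y, 1 / 2 * ‖fderiv ℝ f y‖ ^ 2 * rho n y) -
        ∫ y, 1 / 2 * ‖fderiv ℝ g y‖ ^ 2 * rho n y ≤
      -∫ y, (f y - g y) * ornstein n f y * rho n y := by
  have h1 : ∫ y, (f y - g y) * ornstein n f y * rho n y =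
      ∫ y, (gradInner n g f y * rho n y - ‖fderiv ℝ f y‖ ^ 2 * rho n y) := by
    simp_rw [sub_mul]
    rw [integral_sub (hf.integrable_mul_ornstein hf) (hg.integrable_mul_ornstein hf),
      integral_sub (hg.integrable_gradInner hf) hf.integrable_norm_fderiv_sq,
      hf.integral_norm_fderiv_sq, hg.integral_mul_ornstein hf]
    ring
  rw [h1, ← integral_neg, ← integral_sub]
  · refine integral_mono ?_ ?_ fun y => ?_
    · simp only [mul_assoc]
      exact (hf.integrable_norm_fderiv_sq.const_mul _).sub (hg.integrable_norm_fderiv_sq.const_mul _)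
    · exact ((hg.integrable_gradInner hf).sub hf.integrable_norm_fderiv_sq).neg
    · have h2 : 0 ≤ 1 / 2 * ‖fderiv ℝ f y‖ ^ 2 + 1 / 2 * ‖fderiv ℝ g y‖ ^ 2
          - gradInner n g f y := by
        simp only [← gradInner_self, gradInner, Finset.mul_sum]
        rw [← Finset.sum_add_distrib, ← Finset.sum_sub_distrib]
        refine Finset.sum_nonneg fun i _ => ?_
        nlinarith [sq_nonneg (fderiv ℝ f y (EuclideanSpace.single i 1) -
          fderiv ℝ g y (EuclideanSpace.single i 1))]
      have := mul_nonneg h2 (rho_pos n y).le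
      simp only
      linarith
  · simpa only [mul_assoc] using hf.integrable_norm_fderiv_sq.const_mul _
  · simpa only [mul_assoc] using hg.integrable_norm_fderiv_sq.const_mul _

end Tame

section Nonlinearity

variable {p a μ : ℝ}

theorem log_two_add_sq_ge (z : ℝ) : Real.log 2 ≤ Real.log (2 + z ^ 2) :=
  Real.log_le_log two_pos (by nlinarith [sq_nonneg z])

theorem log_two_add_sq_pos (z : ℝ) : 0 < Real.log (2 + z ^ 2) :=
  (Real.log_pos one_lt_two).trans_le (log_two_add_sq_ge z)

theorem continuous_log_two_add_sq_rpow (b : ℝ) :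
    Continuous fun z : ℝ => Real.log (2 + z ^ 2) ^ b := by
  refine Continuous.rpow_const (Continuous.log (by fun_prop) fun z => by positivity) fun z => ?_
  exact Or.inl (log_two_add_sq_pos z).ne'

theorem continuous_hfun (hp : 1 < p) : Continuous (hfun p a μ) := by
  unfold hfun
  refine Continuous.div ?_ (continuous_log_two_add_sq_rpow a) fun z =>
    (Real.rpow_pos_of_pos (log_two_add_sq_pos z) a).ne'
  exact (continuous_const.mul (continuous_abs.rpow_const fun z => Or.inr (by linarith))).mul
    continuous_id

theorem hasDerivAt_Hfun (hp : 1 < p) (z : ℝ) : HasDerivAt (Hfun p a μ) (hfun p a μ z) z :=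
  intervalIntegral.integral_hasDerivAt_right ((continuous_hfun hp).intervalIntegrable _ _)
    ((continuous_hfun hp).stronglyMeasurableAtFilter _ _) (continuous_hfun hp).continuousAt

theorem Hfun_zero : Hfun p a μ 0 = 0 := by simp [Hfun]

theorem continuous_Hfun (hp : 1 < p) : Continuous (Hfun p a μ) :=
  continuous_iff_continuousAt.2 fun z => (hasDerivAt_Hfun hp z).continuousAt

/-- The power `|ξ|^p` divided by a power of `log (2 + ξ²)`. -/
noncomputable def logDamped (p b ξ : ℝ) : ℝ := |ξ| ^ p / Real.log (2 + ξ ^ 2) ^ b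

theorem logDamped_nonneg (p b ξ : ℝ) : 0 ≤ logDamped p b ξ :=
  div_nonneg (Real.rpow_nonneg (abs_nonneg _) _)
    (Real.rpow_nonneg (log_two_add_sq_pos ξ).le _)

theorem abs_hfun (hp : 1 < p) (z : ℝ) : |hfun p a μ z| = |μ| * logDamped p a z := by
  have h : |z| ^ p = |z| ^ (p - 1) * |z| := by
    rw [← Real.rpow_add_one' (abs_nonneg z) (by linarith)]
    ring_nf
  unfold hfun logDamped
  rw [abs_div, abs_mul, abs_mul, abs_of_nonneg (Real.rpow_nonneg (abs_nonneg z) _),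
    abs_of_nonneg (Real.rpow_nonneg (log_two_add_sq_pos z).le _), h]
  ring

/-- `g` is controlled by `|z|` times the supremum of `logDamped p b` on `[-|z|, |z|]`. -/
def IsDampedBy (p b : ℝ) (g : ℝ → ℝ) : Prop :=
  ∃ c > 0, ∀ z B : ℝ, (∀ ξ, |ξ| ≤ |z| → logDamped p b ξ ≤ B) → |g z| ≤ c * (|z| * B)

theorem isDampedBy_of_hasDerivAt {b c : ℝ} {g g' : ℝ → ℝ} (hc : 0 < c) (h0 : g 0 = 0)
    (hg : ∀ z, HasDerivAt g (g' z) z) (hg' : ∀ z, |g' z| ≤ c * logDamped p b z) :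
    IsDampedBy p b g := by
  refine ⟨c, hc, fun z B hB => ?_⟩
  have h := (convex_Icc (-|z|) |z|).norm_image_sub_le_of_norm_hasDerivWithin_le (C := c * B)
    (f := g) (f' := g') (x := 0) (y := z) (fun ξ _ => (hg ξ).hasDerivWithinAt)
    (fun ξ hξ => (hg' ξ).trans (mul_le_mul_of_nonneg_left (hB ξ (abs_le.2 hξ)) hc.le))
    ⟨neg_nonpos.2 (abs_nonneg z), abs_nonneg z⟩ ⟨neg_abs_le z, le_abs_self z⟩
  simp only [h0, sub_zero, Real.norm_eq_abs] at h
  linarith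

theorem isDampedBy_Hfun (hp : 1 < p) : IsDampedBy p a (Hfun p a μ) := by
  refine isDampedBy_of_hasDerivAt (c := |μ| + 1) (by positivity) Hfun_zero (hasDerivAt_Hfun hp)
    fun z => ?_
  rw [abs_hfun hp]
  nlinarith [logDamped_nonneg p a z]

theorem isDampedBy_mul_hfun (hp : 1 < p) : IsDampedBy p a fun z => z * hfun p a μ z := by
  refine ⟨|μ| + 1, by positivity, fun z B hB => ?_⟩
  have h1 := hB z le_rfl
  have h2 := logDamped_nonneg p a z
  rw [abs_mul, abs_hfun hp]
  calc |z| * (|μ| * logDamped p a z) ≤ |z| * ((|μ| + 1) * B) := by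
        refine mul_le_mul_of_nonneg_left ?_ (abs_nonneg z)
        exact mul_le_mul (by linarith) h1 h2 (by positivity)
    _ = (|μ| + 1) * (|z| * B) := by ring

theorem IsDampedBy.sub {b : ℝ} {f g : ℝ → ℝ} (hf : IsDampedBy p b f) (hg : IsDampedBy p b g) :
    IsDampedBy p b fun z => f z - g z := by
  obtain ⟨c, hc, hf⟩ := hf
  obtain ⟨d, hd, hg⟩ := hg
  refine ⟨c + d, by positivity, fun z B hB => ?_⟩
  have := abs_sub (f z) (g z)
  linarith [hf z B hB, hg z B hB]

theorem IsDampedBy.const_mul {b : ℝ} {f : ℝ → ℝ} (hf : IsDampedBy p b f) (r : ℝ) :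
    IsDampedBy p b fun z => r * f z := by
  obtain ⟨c, hc, hf⟩ := hf
  refine ⟨(|r| + 1) * c, by positivity, fun z B hB => ?_⟩
  rw [abs_mul, mul_assoc]
  exact mul_le_mul (by linarith) (hf z B hB) (abs_nonneg _) (by positivity)

/-- The failure of `h` to be homogeneous of degree `p`, at the level of its primitive. -/
noncomputable def homDefect (p a μ z : ℝ) : ℝ := (p + 1) * Hfun p a μ z - z * hfun p a μ z

theorem mul_hfun_eq (hp : 1 < p) (z : ℝ) :
    z * hfun p a μ z = μ * (|z| ^ (p + 1) * Real.log (2 + z ^ 2) ^ (-a)) := by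
  have h : |z| ^ (p + 1) = |z| ^ (p - 1) * z ^ 2 := by
    rw [← sq_abs z, ← Real.rpow_natCast |z| 2, ← Real.rpow_add' (abs_nonneg z)]
    · congr 1; push_cast; ring
    · push_cast; linarith
  rw [h, Real.rpow_neg (log_two_add_sq_pos z).le]
  unfold hfun
  ring

theorem hasDerivAt_homDefect (hp : 1 < p) (z : ℝ) :
    HasDerivAt (homDefect p a μ)
      (2 * a * μ * (z ^ 2 / (2 + z ^ 2)) * (|z| ^ (p - 1) * z *
        Real.log (2 + z ^ 2) ^ (-a - 1))) z := by
  have h1 : HasDerivAt (fun x : ℝ => |x| ^ (p + 1)) ((p + 1) * |z| ^ (p + 1 - 2) * z) z :=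
    hasDerivAt_abs_rpow z (by linarith)
  have h2 : HasDerivAt (fun x : ℝ => Real.log (2 + x ^ 2)) (2 * z / (2 + z ^ 2)) z := by
    have := (((hasDerivAt_id z).pow 2).const_add 2).log (by simp; positivity)
    simpa using this
  have h3 := h2.rpow_const (p := -a) (Or.inl (log_two_add_sq_pos z).ne')
  have h4 := ((hasDerivAt_Hfun (a := a) (μ := μ) hp z).const_mul (p + 1)).sub
    ((h1.mul h3).const_mul μ)
  have h5 : homDefect p a μ = fun x => (p + 1) * Hfun p a μ x -
      μ * (|x| ^ (p + 1) * Real.log (2 + x ^ 2) ^ (-a)) :=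
    funext fun x => by rw [← mul_hfun_eq hp]; rfl
  rw [h5]
  refine h4.congr_deriv ?_
  have h6 : |z| ^ (p + 1) = |z| ^ (p - 1) * z ^ 2 := by
    rw [← sq_abs z, ← Real.rpow_natCast |z| 2, ← Real.rpow_add' (abs_nonneg z)]
    · congr 1; push_cast; ring
    · push_cast; linarith
  rw [h6, show p + 1 - 2 = p - 1 by ring]
  unfold hfun
  rw [div_eq_mul_inv _ (Real.log (2 + z ^ 2) ^ a), ← Real.rpow_neg (log_two_add_sq_pos z).le]
  ring

theorem isDampedBy_homDefect (hp : 1 < p) (ha : 0 < a) :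
    IsDampedBy p (a + 1) (homDefect p a μ) := by
  refine isDampedBy_of_hasDerivAt (c := 2 * a * |μ| + 1) (by positivity)
    (by simp [homDefect, Hfun_zero]) (hasDerivAt_homDefect hp) fun z => ?_
  have h : |z| ^ p = |z| ^ (p - 1) * |z| := by
    rw [← Real.rpow_add_one' (abs_nonneg z) (by linarith)]
    ring_nf
  have h1 : |(|z| ^ (p - 1) * z * Real.log (2 + z ^ 2) ^ (-a - 1))| = logDamped p (a + 1) z := by
    rw [abs_mul, abs_mul, abs_of_nonneg (Real.rpow_nonneg (abs_nonneg z) _),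
      abs_of_nonneg (Real.rpow_nonneg (log_two_add_sq_pos z).le _), ← h, logDamped, div_eq_mul_inv,
      ← Real.rpow_neg (log_two_add_sq_pos z).le]
    ring_nf
  have h2 : |z ^ 2 / (2 + z ^ 2)| ≤ 1 := by
    rw [abs_of_nonneg (by positivity)]
    exact div_le_one_of_le₀ (by linarith) (by positivity)
  rw [abs_mul, h1, abs_mul, abs_mul, abs_of_pos (show 0 < 2 * a by positivity)]
  refine mul_le_mul_of_nonneg_right ?_ (logDamped_nonneg _ _ _)
  have h3 : 0 ≤ 2 * a * |μ| := by positivity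
  nlinarith

theorem logDamped_le {b Λ r ξ z : ℝ} (hp : 0 ≤ p) (hb : 0 ≤ b) (hr : 0 < r)
    (hΛ : 0 ≤ Λ) (hΛr : Real.exp r ≤ Λ ^ 2) (hξ : |ξ| ≤ |z|) :
    logDamped p b ξ ≤ Λ ^ p / Real.log 2 ^ b + |z| ^ p / r ^ b := by
  have hl2 : 0 < Real.log 2 := Real.log_pos one_lt_two
  unfold logDamped
  rcases le_total |ξ| Λ with h | h
  · have h1 : |ξ| ^ p / Real.log (2 + ξ ^ 2) ^ b ≤ Λ ^ p / Real.log 2 ^ b := by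
      refine div_le_div₀ (by positivity) (Real.rpow_le_rpow (abs_nonneg _) h hp) (by positivity) ?_
      exact Real.rpow_le_rpow hl2.le (log_two_add_sq_ge ξ) hb
    have h2 : 0 ≤ |z| ^ p / r ^ b := by positivity
    linarith
  · have h1 : r ≤ Real.log (2 + ξ ^ 2) := by
      rw [Real.le_log_iff_exp_le (by positivity)]
      have := pow_le_pow_left₀ hΛ h 2
      rw [sq_abs] at this
      linarith
    have h2 : |ξ| ^ p / Real.log (2 + ξ ^ 2) ^ b ≤ |z| ^ p / r ^ b :=
      div_le_div₀ (by positivity) (Real.rpow_le_rpow (abs_nonneg _) hξ hp) (by positivity)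
        (Real.rpow_le_rpow hr.le h1 hb)
    have h3 : 0 ≤ Λ ^ p / Real.log 2 ^ b := by positivity
    linarith

theorem abs_le_abs_rpow_add_one {q : ℝ} (hq : 1 ≤ q) (v : ℝ) : |v| ≤ |v| ^ q + 1 := by
  rcases le_total |v| 1 with h | h
  · linarith [Real.rpow_nonneg (abs_nonneg v) q]
  · linarith [Real.self_le_rpow_of_one_le h hq]

/-- After the self-similar rescaling, damping by `log ^ (-b)` becomes decay like `s ^ (-b)`. -/
theorem IsDampedBy.eventually_le {b : ℝ} {g : ℝ → ℝ} (hp : 1 < p) (hb : 0 < b)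
    (hg : IsDampedBy p b g) : ∃ C > 0, ∀ᶠ s in atTop, ∀ v,
      |Real.exp (-(p + 1) * s / (p - 1)) * g (Real.exp (s / (p - 1)) * v)| ≤
        C * s ^ (-b) * (|v| ^ (p + 1) + 1) := by
  obtain ⟨c, hc, hg⟩ := hg
  have hp1 : 0 < p - 1 := by linarith
  have hl2 : 0 < Real.log 2 := Real.log_pos one_lt_two
  have hr0 : ∀ᶠ r : ℝ in atTop, ∀ v,
      |Real.exp (-(p + 1) * r) * g (Real.exp r * v)| ≤
        2 * c * r ^ (-b) * (|v| ^ (p + 1) + 1) := by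
    have hlim := (tendsto_rpow_mul_exp_neg_mul_atTop_nhds_zero b (p / 2) (by linarith)).eventually
      (gt_mem_nhds (show 0 < Real.log 2 ^ b by positivity))
    filter_upwards [hlim, eventually_gt_atTop 0] with r hr hr0 v
    have hB := hg (Real.exp r * v) _ fun ξ hξ => logDamped_le (p := p) (Λ := Real.exp (r / 2))
      (by linarith) hb.le hr0 (Real.exp_pos _).le
      (by rw [← Real.exp_nat_mul]; exact Real.exp_le_exp.2 (by push_cast; linarith)) hξ
    have hz : |Real.exp r * v| = Real.exp r * |v| := by rw [abs_mul, abs_of_pos (Real.exp_pos _)]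
    have hv : |v| ^ (p + 1) = |v| ^ p * |v| := Real.rpow_add_one' (abs_nonneg _) (by linarith)
    rw [abs_mul, abs_of_pos (Real.exp_pos _)]
    have hsmall : Real.exp (-(p / 2) * r) / Real.log 2 ^ b ≤ r ^ (-b) := by
      rw [Real.rpow_neg hr0.le, div_le_iff₀ (by positivity), inv_mul_eq_div,
        le_div_iff₀ (by positivity)]
      linarith
    calc Real.exp (-(p + 1) * r) * |g (Real.exp r * v)|
        ≤ Real.exp (-(p + 1) * r) * _ := mul_le_mul_of_nonneg_left hB (Real.exp_pos _).le
      _ = c * (|v| * (Real.exp (-(p / 2) * r) / Real.log 2 ^ b) + |v| ^ (p + 1) * r ^ (-b)) := by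
          rw [hz, Real.mul_rpow (Real.exp_pos _).le (abs_nonneg _), ← Real.exp_mul, ← Real.exp_mul,
            hv, Real.rpow_neg hr0.le]
          have e1 : Real.exp (-(p + 1) * r) * Real.exp r * Real.exp (r / 2 * p) =
              Real.exp (-(p / 2) * r) := by
            rw [← Real.exp_add, ← Real.exp_add]; congr 1; ring
          have e2 : Real.exp (-(p + 1) * r) * Real.exp r * Real.exp (r * p) = 1 := by
            rw [← Real.exp_add, ← Real.exp_add, Real.exp_eq_one_iff]; ring
          rw [← e1]
          linear_combination (c * |v| * |v| ^ p * (r ^ b)⁻¹) * e2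
      _ ≤ c * (|v| * r ^ (-b) + |v| ^ (p + 1) * r ^ (-b)) := by gcongr
      _ ≤ 2 * c * r ^ (-b) * (|v| ^ (p + 1) + 1) := by
          have h1 := abs_le_abs_rpow_add_one (q := p + 1) (by linarith) v
          have h2 : 0 < c * r ^ (-b) := by positivity
          nlinarith
  have hdiv : Tendsto (fun s : ℝ => s / (p - 1)) atTop atTop := tendsto_id.atTop_div_const hp1
  refine ⟨2 * c * (p - 1) ^ b, by positivity, ?_⟩
  filter_upwards [hdiv.eventually hr0, eventually_gt_atTop 0] with s hs hs0 v
  have h := hs v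
  rw [Real.div_rpow hs0.le hp1.le, Real.rpow_neg hp1.le, div_inv_eq_mul, ← mul_div_assoc] at h
  linarith

/-- The zeroth-order part of the energy density. -/
noncomputable def potential (p a μ s v : ℝ) : ℝ :=
  v ^ 2 / (2 * (p - 1)) - |v| ^ (p + 1) / (p + 1)
    - Real.exp (-(p + 1) * s / (p - 1)) * Hfun p a μ (Real.exp (s / (p - 1)) * v)

/-- The derivative of the potential in its last argument. -/
noncomputable def force (p a μ s v : ℝ) : ℝ :=
  v / (p - 1) - |v| ^ (p - 1) * v
    - Real.exp (-p * s / (p - 1)) * hfun p a μ (Real.exp (s / (p - 1)) * v)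

/-- The explicit time derivative of the potential. -/
noncomputable def timeForce (p a μ s v : ℝ) : ℝ :=
  (p - 1)⁻¹ * (Real.exp (-(p + 1) * s / (p - 1)) *
    homDefect p a μ (Real.exp (s / (p - 1)) * v))

theorem continuous_potential (hp : 1 < p) :
    Continuous fun q : ℝ × ℝ => potential p a μ q.1 q.2 := by
  have h1 : Continuous fun q : ℝ × ℝ => |q.2| ^ (p + 1) :=
    (continuous_abs.comp continuous_snd).rpow_const fun _ => Or.inr (by linarith)
  have h2 := continuous_Hfun (a := a) (μ := μ) hp
  unfold potential
  fun_prop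

theorem continuous_force (hp : 1 < p) : Continuous fun q : ℝ × ℝ => force p a μ q.1 q.2 := by
  have h1 : Continuous fun q : ℝ × ℝ => |q.2| ^ (p - 1) :=
    (continuous_abs.comp continuous_snd).rpow_const fun _ => Or.inr (by linarith)
  have h2 := continuous_hfun (a := a) (μ := μ) hp
  unfold force
  fun_prop

theorem continuous_timeForce (hp : 1 < p) :
    Continuous fun q : ℝ × ℝ => timeForce p a μ q.1 q.2 := by
  have h1 := continuous_hfun (a := a) (μ := μ) hp
  have h2 := continuous_Hfun (a := a) (μ := μ) hp
  unfold timeForce homDefect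
  fun_prop

theorem hasDerivAt_potential (hp : 1 < p) {u : ℝ → ℝ} {u' s : ℝ} (hu : HasDerivAt u u' s) :
    HasDerivAt (fun t => potential p a μ t (u t))
      (force p a μ s (u s) * u' + timeForce p a μ s (u s)) s := by
  have hp1 : p - 1 ≠ 0 := by linarith
  have hp2 : p + 1 ≠ 0 := by linarith
  have h1 : HasDerivAt (fun t => u t ^ 2 / (2 * (p - 1))) (u s * u' / (p - 1)) s := by
    refine ((hu.pow 2).div_const (2 * (p - 1))).congr_deriv ?_
    field_simp
    simp only [Nat.cast_ofNat, Nat.add_one_sub_one, pow_one]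
    ring
  have h2 : HasDerivAt (fun t => |u t| ^ (p + 1) / (p + 1)) (|u s| ^ (p - 1) * u s * u') s := by
    refine (((hasDerivAt_abs_rpow (u s) (p := p + 1) (by linarith)).comp s hu).div_const
      (p + 1)).congr_deriv ?_
    rw [show p + 1 - 2 = p - 1 by ring]
    field_simp
  have h3 : HasDerivAt (fun t : ℝ => Real.exp (t / (p - 1)))
      (Real.exp (s / (p - 1)) * (1 / (p - 1))) s := ((hasDerivAt_id s).div_const (p - 1)).exp
  have h4 : HasDerivAt (fun t : ℝ => Real.exp (-(p + 1) * t / (p - 1)))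
      (Real.exp (-(p + 1) * s / (p - 1)) * (-(p + 1) * 1 / (p - 1))) s :=
    (((hasDerivAt_id s).const_mul (-(p + 1))).div_const (p - 1)).exp
  have h5 := (hasDerivAt_Hfun (a := a) (μ := μ) hp (Real.exp (s / (p - 1)) * u s)).comp s
    (h3.mul hu)
  refine ((h1.sub h2).sub (h4.mul h5)).congr_deriv ?_
  have e : Real.exp (-p * s / (p - 1)) =
      Real.exp (-(p + 1) * s / (p - 1)) * Real.exp (s / (p - 1)) := by
    rw [← Real.exp_add]; congr 1; ring
  simp only [force, timeForce, homDefect, e, Function.comp, Pi.mul_apply]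
  field_simp
  ring

end Nonlinearity

section StaticEstimate

variable {n : ℕ} {p a μ M : ℝ} {f : EuclideanSpace ℝ (Fin n) → ℝ}

/-- The energy of a profile `f` at time `s`. -/
noncomputable def profileEnergy (n : ℕ) (p a μ s : ℝ) (f : EuclideanSpace ℝ (Fin n) → ℝ) : ℝ :=
  (∫ y, 1 / 2 * ‖fderiv ℝ f y‖ ^ 2 * rho n y) + ∫ y, potential p a μ s (f y) * rho n y

theorem integrable_comp_mul_rho {Φ : ℝ → ℝ} (hΦ : Continuous Φ) (hf : Continuous f)
    (hM : ∀ y, |f y| ≤ M) : Integrable fun y => Φ (f y) * rho n y := by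
  obtain ⟨C, hC⟩ := (isCompact_Icc (a := -M) (b := M)).exists_bound_of_continuousOn hΦ.continuousOn
  exact integrable_mul_rho (hΦ.comp hf) fun y => hC _ (abs_le.1 (hM y))

theorem IsTame.integrable_half_norm_fderiv_sq (hf : IsTame n M f) :
    Integrable fun y => 1 / 2 * ‖fderiv ℝ f y‖ ^ 2 * rho n y := by
  simpa only [mul_assoc] using hf.integrable_norm_fderiv_sq.const_mul _

theorem continuous_abs_rpow {q : ℝ} (hq : 0 ≤ q) : Continuous fun v : ℝ => |v| ^ q :=
  continuous_abs.rpow_const fun _ => Or.inr hq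

theorem IsTame.energy_eq (hf : IsTame n M f) (hp : 1 < p) (s : ℝ) :
    (∫ y, ((1 / 2) * ‖fderiv ℝ f y‖ ^ 2 + f y ^ 2 / (2 * (p - 1))
        - |f y| ^ (p + 1) / (p + 1)) * rho n y) +
      -Real.exp (-(p + 1) * s / (p - 1)) *
        ∫ y, Hfun p a μ (Real.exp (s / (p - 1)) * f y) * rho n y =
    profileEnergy n p a μ s f := by
  have h1 : Integrable fun y => (f y ^ 2 / (2 * (p - 1)) - |f y| ^ (p + 1) / (p + 1)) * rho n y :=
    integrable_comp_mul_rho (Φ := fun v => v ^ 2 / (2 * (p - 1)) - |v| ^ (p + 1) / (p + 1))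
      (by have := continuous_abs_rpow (q := p + 1) (by linarith); fun_prop) hf.continuous hf.abs_le
  have h2 : Integrable fun y => Hfun p a μ (Real.exp (s / (p - 1)) * f y) * rho n y :=
    integrable_comp_mul_rho (Φ := fun v => Hfun p a μ (Real.exp (s / (p - 1)) * v))
      (by have := continuous_Hfun (a := a) (μ := μ) hp; fun_prop) hf.continuous hf.abs_le
  have h3 : ∫ y, potential p a μ s (f y) * rho n y =
      (∫ y, (f y ^ 2 / (2 * (p - 1)) - |f y| ^ (p + 1) / (p + 1)) * rho n y) +
      -Real.exp (-(p + 1) * s / (p - 1)) *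
        ∫ y, Hfun p a μ (Real.exp (s / (p - 1)) * f y) * rho n y := by
    rw [← integral_const_mul, ← integral_add h1 (h2.const_mul _)]
    congr 1 with y
    unfold potential
    ring
  rw [profileEnergy, h3, ← add_assoc, ← integral_add hf.integrable_half_norm_fderiv_sq h1]
  congr 2 with y
  ring

/-- The identity obtained by testing the equation with the solution itself. -/
theorem IsTame.two_mul_energy_add (hf : IsTame n M f) (hp : 1 < p) (s : ℝ)
    {g : EuclideanSpace ℝ (Fin n) → ℝ}
    (hg : ∀ y, g y = ornstein n f y - force p a μ s (f y)) :
    2 * profileEnergy n p a μ s f + ∫ y, f y * g y * rho n y =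
      (p - 1) / (p + 1) * (∫ y, |f y| ^ (p + 1) * rho n y) +
      ∫ y, Real.exp (-(p + 1) * s / (p - 1)) *
        (Real.exp (s / (p - 1)) * f y * hfun p a μ (Real.exp (s / (p - 1)) * f y) -
          2 * Hfun p a μ (Real.exp (s / (p - 1)) * f y)) * rho n y := by
  have hforce : Continuous (force p a μ s) := (continuous_force hp).comp (by fun_prop : Continuous
    fun v : ℝ => (s, v))
  have hpot : Continuous (potential p a μ s) := (continuous_potential hp).comp
    (by fun_prop : Continuous fun v : ℝ => (s, v))
  have h1 : Integrable fun y => f y * force p a μ s (f y) * rho n y :=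
    integrable_comp_mul_rho (Φ := fun v => v * force p a μ s v) (by fun_prop)
      hf.continuous hf.abs_le
  have h2 : Integrable fun y => potential p a μ s (f y) * rho n y :=
    integrable_comp_mul_rho hpot hf.continuous hf.abs_le
  have h3 : Integrable fun y => |f y| ^ (p + 1) * rho n y :=
    integrable_comp_mul_rho (continuous_abs_rpow (by linarith)) hf.continuous hf.abs_le
  have h4 : ∫ y, f y * g y * rho n y = -(∫ y, ‖fderiv ℝ f y‖ ^ 2 * rho n y) -
      ∫ y, f y * force p a μ s (f y) * rho n y := by
    rw [hf.integral_norm_fderiv_sq, neg_neg, ← integral_sub (hf.integrable_mul_ornstein hf) h1]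
    congr 1 with y
    rw [hg]
    ring
  have h5 : ∫ y, 1 / 2 * ‖fderiv ℝ f y‖ ^ 2 * rho n y =
      1 / 2 * ∫ y, ‖fderiv ℝ f y‖ ^ 2 * rho n y := by
    rw [← integral_const_mul]
    congr 1 with y
    ring
  have h6 : ∫ y, Real.exp (-(p + 1) * s / (p - 1)) *
        (Real.exp (s / (p - 1)) * f y * hfun p a μ (Real.exp (s / (p - 1)) * f y) -
          2 * Hfun p a μ (Real.exp (s / (p - 1)) * f y)) * rho n y =
      2 * (∫ y, potential p a μ s (f y) * rho n y) -
        (∫ y, f y * force p a μ s (f y) * rho n y) -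
        (p - 1) / (p + 1) * ∫ y, |f y| ^ (p + 1) * rho n y := by
    have h7 : Integrable fun y => 2 * (potential p a μ s (f y) * rho n y) -
        f y * force p a μ s (f y) * rho n y := (h2.const_mul 2).sub h1
    rw [← integral_const_mul, ← integral_const_mul, ← integral_sub (h2.const_mul _) h1,
      ← integral_sub h7 (h3.const_mul _)]
    congr 1 with y
    have hv : |f y| ^ (p + 1) = |f y| ^ (p - 1) * f y ^ 2 := by
      rw [← sq_abs (f y), ← Real.rpow_natCast |f y| 2, ← Real.rpow_add' (abs_nonneg _)]
      · congr 1; push_cast; ring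
      · push_cast; linarith
    have e : Real.exp (-p * s / (p - 1)) =
        Real.exp (-(p + 1) * s / (p - 1)) * Real.exp (s / (p - 1)) := by
      rw [← Real.exp_add]; congr 1; ring
    have hp1 : p - 1 ≠ 0 := by linarith
    have hp2 : p + 1 ≠ 0 := by linarith
    simp only [potential, force, e, hv]
    field_simp
    ring
  rw [h4, h6, profileEnergy, h5]
  ring

theorem sq_le_abs_rpow_add_one {q : ℝ} (hq : 2 ≤ q) (v : ℝ) : v ^ 2 ≤ |v| ^ q + 1 := by
  rw [← sq_abs]
  rcases le_total |v| 1 with h | h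
  · nlinarith [Real.rpow_nonneg (abs_nonneg v) q, abs_nonneg v]
  · have := Real.rpow_le_rpow_of_exponent_le h hq
    rw [Real.rpow_two] at this
    linarith

theorem abs_integral_mul_rho_le (hp : 1 < p) (hf : Continuous f) (hM : ∀ y, |f y| ≤ M)
    {Φ : ℝ → ℝ} {C : ℝ} (hΦ : ∀ v, |Φ v| ≤ C * (|v| ^ (p + 1) + 1)) :
    |∫ y, Φ (f y) * rho n y| ≤ C * ((∫ y, |f y| ^ (p + 1) * rho n y) + 1) := by
  have h3 : Integrable fun y => |f y| ^ (p + 1) * rho n y :=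
    integrable_comp_mul_rho (continuous_abs_rpow (by linarith)) hf hM
  have h := norm_integral_le_of_norm_le (f := fun y => Φ (f y) * rho n y)
    ((h3.add (integrable_rho n)).const_mul C) (Eventually.of_forall fun y => by
      rw [norm_mul, Real.norm_of_nonneg (rho_pos n y).le]
      refine (mul_le_mul_of_nonneg_right (hΦ (f y)) (rho_pos n y).le).trans_eq ?_
      simp only [Pi.add_apply]
      ring)
  rw [integral_const_mul] at h
  simp only [Pi.add_apply] at h
  rwa [integral_add h3 (integrable_rho n), integral_rho] at h

/-- The differential inequality for the energy, at a fixed large time. -/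
theorem exists_energy_production_le (n : ℕ) (hp : 1 < p) (ha : 0 < a) (μ : ℝ) :
    ∃ γ > 0, ∃ C > 0, ∀ᶠ s : ℝ in atTop, ∀ (M : ℝ) (f g : EuclideanSpace ℝ (Fin n) → ℝ),
      IsTame n M f → Continuous g → (∀ y, |g y| ≤ M) →
      (∀ y, g y = ornstein n f y - force p a μ s (f y)) →
      -(∫ y, g y ^ 2 * rho n y) + (∫ y, timeForce p a μ s (f y) * rho n y) -
          γ * s ^ (-a - 1) * profileEnergy n p a μ s f ≤
        -(1 / 2) * (∫ y, g y ^ 2 * rho n y) + C * s ^ (-a - 1) := by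
  have hp1 : 0 < p - 1 := by linarith
  obtain ⟨C₁, hC₁, h₁⟩ := (isDampedBy_homDefect (μ := μ) hp ha).eventually_le hp (by linarith)
  obtain ⟨C₂, hC₂, h₂⟩ := ((isDampedBy_mul_hfun (a := a) (μ := μ) hp).sub
    ((isDampedBy_Hfun (a := a) (μ := μ) hp).const_mul 2)).eventually_le hp ha
  set c : ℝ := (p - 1) / (p + 1) with hc
  have hc0 : 0 < c := by positivity
  set D : ℝ := (p - 1)⁻¹ * C₁ with hD
  have hD0 : 0 < D := by positivity
  have hlim₁ : ∀ᶠ s : ℝ in atTop, C₂ * s ^ (-a) < c / 4 := by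
    have h := (tendsto_rpow_neg_atTop ha).const_mul C₂
    rw [mul_zero] at h
    exact h.eventually (gt_mem_nhds (by positivity))
  have hlim₂ : ∀ᶠ s : ℝ in atTop, D * (2 / c ^ 2) * s ^ (-(a + 1)) < 1 / 2 := by
    have h := (tendsto_rpow_neg_atTop (show 0 < a + 1 by linarith)).const_mul (D * (2 / c ^ 2))
    rw [mul_zero] at h
    exact h.eventually (gt_mem_nhds (by positivity))
  refine ⟨D * (4 / c), by positivity, 2 * D, by positivity, ?_⟩
  filter_upwards [h₁, h₂, hlim₁, hlim₂, eventually_gt_atTop 0] with s h₁ h₂ hs₁ hs₂ hs0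
    M f g hf hgc hgM hg
  rw [show -(a + 1) = -a - 1 by ring] at hs₂
  rw [show -(a + 1) = -a - 1 by ring] at h₁
  set X := ∫ y, |f y| ^ (p + 1) * rho n y with hX
  set G := ∫ y, g y ^ 2 * rho n y with hG
  have hX0 : 0 ≤ X := integral_nonneg fun y =>
    mul_nonneg (Real.rpow_nonneg (abs_nonneg _) _) (rho_pos n y).le
  have hG0 : 0 ≤ G := integral_nonneg fun y => mul_nonneg (sq_nonneg _) (rho_pos n y).le
  have hσ : 0 < s ^ (-a - 1) := by positivity
  have hT : ∫ y, timeForce p a μ s (f y) * rho n y ≤ D * s ^ (-a - 1) * (X + 1) := by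
    refine (le_abs_self _).trans (abs_integral_mul_rho_le (Φ := timeForce p a μ s) hp hf.continuous
      hf.abs_le fun v => ?_)
    rw [timeForce, abs_mul, abs_of_pos (inv_pos.2 hp1), hD, mul_assoc, mul_assoc]
    have := h₁ v
    rw [mul_assoc] at this
    exact mul_le_mul_of_nonneg_left this (inv_pos.2 hp1).le
  have hN := abs_integral_mul_rho_le (Φ := fun v => Real.exp (-(p + 1) * s / (p - 1)) *
      (Real.exp (s / (p - 1)) * v * hfun p a μ (Real.exp (s / (p - 1)) * v) -
        2 * Hfun p a μ (Real.exp (s / (p - 1)) * v))) hp hf.continuous hf.abs_le h₂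
  have hid := hf.two_mul_energy_add hp s hg
  have hX1 : Integrable fun y => |f y| ^ (p + 1) * rho n y :=
    integrable_comp_mul_rho (continuous_abs_rpow (by linarith)) hf.continuous hf.abs_le
  have hG1 : Integrable fun y => g y ^ 2 * rho n y :=
    integrable_comp_mul_rho (continuous_pow 2) hgc hgM
  have hcross : ∫ y, f y * g y * rho n y ≤ c / 4 * (X + 1) + 1 / c * G := by
    have hX2 : Integrable fun y => |f y| ^ (p + 1) * rho n y + rho n y := hX1.add (integrable_rho n)
    have hX3 : X + 1 = ∫ y, (|f y| ^ (p + 1) * rho n y + rho n y) := by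
      rw [integral_add hX1 (integrable_rho n), integral_rho]
    rw [hX3, hG, ← integral_const_mul, ← integral_const_mul,
      ← integral_add (hX2.const_mul _) (hG1.const_mul _)]
    refine integral_mono ?_ ((hX2.const_mul _).add (hG1.const_mul _)) fun y => ?_
    · refine integrable_mul_rho (M := M * M) (hf.continuous.mul hgc) fun y => ?_
      rw [abs_mul]
      exact mul_le_mul (hf.abs_le y) (hgM y) (abs_nonneg _) hf.nonneg
    · have h3 : f y * g y ≤ c / 4 * (f y) ^ 2 + 1 / c * g y ^ 2 := by
        have h4 : c / 4 * (f y) ^ 2 + 1 / c * g y ^ 2 - f y * g y =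
            (c * f y - 2 * g y) ^ 2 / (4 * c) := by field_simp; ring
        have h5 : 0 ≤ (c * f y - 2 * g y) ^ 2 / (4 * c) := by positivity
        linarith
      have h4 := mul_le_mul_of_nonneg_left
        (sq_le_abs_rpow_add_one (q := p + 1) (by linarith) (f y)) (show 0 ≤ c / 4 by positivity)
      have h5 := mul_le_mul_of_nonneg_right (h3.trans (add_le_add_left h4 _)) (rho_pos n y).le
      simp only
      linarith
  have hN' := (neg_le_of_abs_le hN)
  have hXE : X ≤ 4 / c * profileEnergy n p a μ s f + 2 / c ^ 2 * G + 1 := by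
    have h3 : C₂ * s ^ (-a) * (X + 1) ≤ c / 4 * (X + 1) :=
      mul_le_mul_of_nonneg_right hs₁.le (by linarith)
    have h4 : c / 2 * X ≤ 2 * profileEnergy n p a μ s f + 1 / c * G + c / 2 := by
      linarith
    have h5 := mul_le_mul_of_nonneg_left h4 (show 0 ≤ 2 / c by positivity)
    have e1 : 2 / c * (c / 2 * X) = X := by field_simp
    have e2 : 2 / c * (2 * profileEnergy n p a μ s f + 1 / c * G + c / 2) =
        4 / c * profileEnergy n p a μ s f + 2 / c ^ 2 * G + 1 := by field_simp; ring
    linarith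
  have h6 := mul_le_mul_of_nonneg_left hXE (show 0 ≤ D * s ^ (-a - 1) by positivity)
  have h7 := mul_le_mul_of_nonneg_right hs₂.le hG0
  linarith

end StaticEstimate

section Orbit

variable {n : ℕ} {p a μ M s₀ s₁ s₂ : ℝ} {w : EuclideanSpace ℝ (Fin n) → ℝ → ℝ}

/-- The right-hand side of equation (W), i.e. the time derivative of a solution. -/
noncomputable def velocity (n : ℕ) (p a μ : ℝ) (w : EuclideanSpace ℝ (Fin n) → ℝ → ℝ) (s : ℝ)
    (y : EuclideanSpace ℝ (Fin n)) : ℝ :=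
  ornstein n (fun z => w z s) y - force p a μ s (w y s)

theorem SolvesW.deriv_eq (hw : SolvesW n p a μ s₀ w) {s : ℝ} (hs : s₀ ≤ s)
    (y : EuclideanSpace ℝ (Fin n)) : deriv (fun s' => w y s') s = velocity n p a μ w s y := by
  rw [hw.2.2 y s hs, velocity, ornstein, force]
  ring

/-- A solution of equation (W) on a compact time interval with uniform bounds. -/
structure IsTameOrbit (n : ℕ) (p a μ M s₁ s₂ : ℝ) (w : EuclideanSpace ℝ (Fin n) → ℝ → ℝ) :
    Prop where
  tame : ∀ s ∈ Set.Icc s₁ s₂, IsTame n M fun y => w y s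
  hasDerivAt : ∀ s ∈ Set.Icc s₁ s₂, ∀ y, HasDerivAt (w y) (velocity n p a μ w s y) s
  abs_velocity_le : ∀ s ∈ Set.Icc s₁ s₂, ∀ y, |velocity n p a μ w s y| ≤ M
  abs_force_le : ∀ s ∈ Set.Icc s₁ s₂, ∀ y, |force p a μ s (w y s)| ≤ M
  abs_timeForce_le : ∀ s ∈ Set.Icc s₁ s₂, ∀ y, |timeForce p a μ s (w y s)| ≤ M

theorem SolvesW.exists_isTameOrbit (hw : SolvesW n p a μ s₀ w) (hb : BoundedW n s₀ w) (hp : 1 < p)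
    (h₁ : s₀ ≤ s₁) (h₁₂ : s₁ < s₂) : ∃ M, IsTameOrbit n p a μ M s₁ s₂ w := by
  obtain ⟨M, hM⟩ := hb s₁ s₂ h₁ h₁₂
  have hK : IsCompact (Set.Icc s₁ s₂ ×ˢ Set.Icc (-M) M) := isCompact_Icc.prod isCompact_Icc
  obtain ⟨F, hF⟩ := hK.exists_bound_of_continuousOn
    (continuous_force (a := a) (μ := μ) hp).continuousOn
  obtain ⟨T, hT⟩ := hK.exists_bound_of_continuousOn
    (continuous_timeForce (a := a) (μ := μ) hp).continuousOn
  have hmem : ∀ s ∈ Set.Icc s₁ s₂, ∀ y, (s, w y s) ∈ Set.Icc s₁ s₂ ×ˢ Set.Icc (-M) M :=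
    fun s hs y => ⟨hs, abs_le.1 (hM y s hs).1⟩
  have hF' : ∀ s ∈ Set.Icc s₁ s₂, ∀ y, |force p a μ s (w y s)| ≤ F :=
    fun s hs y => hF _ (hmem s hs y)
  have hT' : ∀ s ∈ Set.Icc s₁ s₂, ∀ y, |timeForce p a μ s (w y s)| ≤ T :=
    fun s hs y => hT _ (hmem s hs y)
  have hs₁ := Set.left_mem_Icc.2 h₁₂.le
  have hM0 : 0 ≤ M := (abs_nonneg _).trans (hM 0 s₁ hs₁).1
  have hF0 : 0 ≤ F := (abs_nonneg _).trans (hF' s₁ hs₁ 0)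
  have hT0 : 0 ≤ T := (abs_nonneg _).trans (hT' s₁ hs₁ 0)
  have hV : ∀ s ∈ Set.Icc s₁ s₂, ∀ y, |velocity n p a μ w s y| ≤ M := fun s hs y => by
    rw [← hw.deriv_eq (h₁.trans hs.1)]
    exact (hM y s hs).2.2
  refine ⟨M + F + T, fun s hs => ⟨hw.1 s (h₁.trans hs.1), fun y => ?_, fun y => ?_, fun y => ?_⟩,
    fun s hs y => ?_, fun s hs y => ?_, fun s hs y => ?_, fun s hs y => ?_⟩
  · linarith [(hM y s hs).1]
  · linarith [(hM y s hs).2.1]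
  · have h2 := abs_add_le (velocity n p a μ w s y) (force p a μ s (w y s))
    rw [velocity, sub_add_cancel, ← velocity] at h2
    linarith [hV s hs y, hF' s hs y]
  · rw [← hw.deriv_eq (h₁.trans hs.1)]
    exact (hw.2.1 y s (h₁.trans hs.1)).hasDerivAt
  · linarith [hV s hs y]
  · linarith [hF' s hs y]
  · linarith [hT' s hs y]

namespace IsTameOrbit

variable {s t : ℝ}

theorem continuous_velocity (hw : IsTameOrbit n p a μ M s₁ s₂ w) (hp : 1 < p)
    (hs : s ∈ Set.Icc s₁ s₂) : Continuous (velocity n p a μ w s) := by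
  unfold velocity
  exact (continuous_ornstein (hw.tame s hs).contDiff).sub
    ((continuous_force hp).comp (continuous_const.prodMk (hw.tame s hs).continuous))

theorem abs_sub_le (hw : IsTameOrbit n p a μ M s₁ s₂ w) (hs : s ∈ Set.Icc s₁ s₂)
    (ht : t ∈ Set.Icc s₁ s₂) (y : EuclideanSpace ℝ (Fin n)) :
    |w y s - w y t| ≤ M * |s - t| :=
  (convex_Icc s₁ s₂).norm_image_sub_le_of_norm_hasDerivWithin_le
    (fun r hr => (hw.hasDerivAt r hr y).hasDerivWithinAt)
    (fun r hr => hw.abs_velocity_le r hr y) ht hs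

theorem hasDerivAt_potential (hw : IsTameOrbit n p a μ M s₁ s₂ w) (hp : 1 < p)
    (hs : s ∈ Set.Icc s₁ s₂) (y : EuclideanSpace ℝ (Fin n)) :
    HasDerivAt (fun r => potential p a μ r (w y r))
      (force p a μ s (w y s) * velocity n p a μ w s y + timeForce p a μ s (w y s)) s :=
  _root_.hasDerivAt_potential hp (hw.hasDerivAt s hs y)

theorem abs_potential_sub_le (hw : IsTameOrbit n p a μ M s₁ s₂ w) (hp : 1 < p)
    (hs : s ∈ Set.Icc s₁ s₂) (ht : t ∈ Set.Icc s₁ s₂) (y : EuclideanSpace ℝ (Fin n)) :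
    |potential p a μ s (w y s) - potential p a μ t (w y t)| ≤ (M * M + M) * |s - t| := by
  refine (convex_Icc s₁ s₂).norm_image_sub_le_of_norm_hasDerivWithin_le
    (f := fun r => potential p a μ r (w y r))
    (fun r hr => (hw.hasDerivAt_potential hp hr y).hasDerivWithinAt) (fun r hr => ?_) ht hs
  refine (abs_add_le _ _).trans (add_le_add ?_ (hw.abs_timeForce_le r hr y))
  rw [abs_mul]
  exact mul_le_mul (hw.abs_force_le r hr y) (hw.abs_velocity_le r hr y) (abs_nonneg _)
    (hw.tame r hr).nonneg

/-- The density of an upper bound for the energy increment between times `t` and `s`. -/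
noncomputable def increment (n : ℕ) (p a μ : ℝ) (w : EuclideanSpace ℝ (Fin n) → ℝ → ℝ) (s t : ℝ)
    (y : EuclideanSpace ℝ (Fin n)) : ℝ :=
  potential p a μ s (w y s) - potential p a μ t (w y t) -
    (w y s - w y t) * ornstein n (fun z => w z s) y

theorem continuous_increment (hw : IsTameOrbit n p a μ M s₁ s₂ w) (hp : 1 < p)
    (hs : s ∈ Set.Icc s₁ s₂) (ht : t ∈ Set.Icc s₁ s₂) : Continuous (increment n p a μ w s t) := by
  have h1 := (hw.tame s hs).continuous
  have h2 := (hw.tame t ht).continuous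
  exact (((continuous_potential hp).comp (continuous_const.prodMk h1)).sub
    ((continuous_potential hp).comp (continuous_const.prodMk h2))).sub
    ((h1.sub h2).mul (continuous_ornstein (hw.tame s hs).contDiff))

theorem abs_increment_le (hw : IsTameOrbit n p a μ M s₁ s₂ w) (hp : 1 < p)
    (hs : s ∈ Set.Icc s₁ s₂) (ht : t ∈ Set.Icc s₁ s₂) (y : EuclideanSpace ℝ (Fin n)) :
    |increment n p a μ w s t y| ≤ (2 * (M * M) + M) * |s - t| := by
  have h1 := hw.abs_potential_sub_le hp hs ht y
  have h2 : |(w y s - w y t) * ornstein n (fun z => w z s) y| ≤ M * |s - t| * M := by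
    rw [abs_mul]
    exact mul_le_mul (hw.abs_sub_le hs ht y) ((hw.tame s hs).abs_ornstein_le y) (abs_nonneg _)
      (mul_nonneg (hw.tame s hs).nonneg (abs_nonneg _))
  have h3 := abs_sub (potential p a μ s (w y s) - potential p a μ t (w y t))
    ((w y s - w y t) * ornstein n (fun z => w z s) y)
  unfold increment
  linarith

theorem integrable_increment (hw : IsTameOrbit n p a μ M s₁ s₂ w) (hp : 1 < p)
    (hs : s ∈ Set.Icc s₁ s₂) (ht : t ∈ Set.Icc s₁ s₂) :
    Integrable fun y => increment n p a μ w s t y * rho n y :=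
  integrable_mul_rho (hw.continuous_increment hp hs ht) (hw.abs_increment_le hp hs ht)

theorem energy_sub_le (hw : IsTameOrbit n p a μ M s₁ s₂ w) (hp : 1 < p)
    (hs : s ∈ Set.Icc s₁ s₂) (ht : t ∈ Set.Icc s₁ s₂) :
    Etot n p a μ w s - Etot n p a μ w t ≤ ∫ y, increment n p a μ w s t y * rho n y := by
  have hpot : ∀ r, Continuous (potential p a μ r) := fun r =>
    (continuous_potential hp).comp (continuous_const.prodMk continuous_id)
  have h1 : Integrable fun y => potential p a μ s (w y s) * rho n y :=
    integrable_comp_mul_rho (hpot s) (hw.tame s hs).continuous (hw.tame s hs).abs_le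
  have h2 : Integrable fun y => potential p a μ t (w y t) * rho n y :=
    integrable_comp_mul_rho (hpot t) (hw.tame t ht).continuous (hw.tame t ht).abs_le
  have h3 : Integrable fun y => (w y s - w y t) * ornstein n (fun z => w z s) y * rho n y := by
    simp_rw [sub_mul]
    exact ((hw.tame s hs).integrable_mul_ornstein (hw.tame s hs)).sub
      ((hw.tame t ht).integrable_mul_ornstein (hw.tame s hs))
  have h4 : ∫ y, increment n p a μ w s t y * rho n y =
      (∫ y, potential p a μ s (w y s) * rho n y) - (∫ y, potential p a μ t (w y t) * rho n y) -
        ∫ y, (w y s - w y t) * ornstein n (fun z => w z s) y * rho n y := by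
    have h12 : Integrable fun y => potential p a μ s (w y s) * rho n y -
        potential p a μ t (w y t) * rho n y := h1.sub h2
    rw [← integral_sub h1 h2, ← integral_sub h12 h3]
    simp only [increment, sub_mul]
  have h5 := (hw.tame s hs).dirichlet_sub_le (hw.tame t ht)
  have e1 : Etot n p a μ w s = profileEnergy n p a μ s (fun y => w y s) :=
    (hw.tame s hs).energy_eq hp s
  have e2 : Etot n p a μ w t = profileEnergy n p a μ t (fun y => w y t) :=
    (hw.tame t ht).energy_eq hp t
  rw [e1, e2, h4, profileEnergy, profileEnergy]
  linarith

theorem energy_sub_le_abs (hw : IsTameOrbit n p a μ M s₁ s₂ w) (hp : 1 < p)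
    (hs : s ∈ Set.Icc s₁ s₂) (ht : t ∈ Set.Icc s₁ s₂) :
    Etot n p a μ w s - Etot n p a μ w t ≤ (2 * (M * M) + M) * |s - t| := by
  refine (hw.energy_sub_le hp hs ht).trans ?_
  have h := integral_mono (hw.integrable_increment hp hs ht)
    ((integrable_rho n).const_mul ((2 * (M * M) + M) * |s - t|)) fun y =>
    mul_le_mul_of_nonneg_right ((le_abs_self _).trans (hw.abs_increment_le hp hs ht y))
      (rho_pos n y).le
  rwa [integral_const_mul, integral_rho, mul_one] at h

theorem absolutelyContinuous_energy (hw : IsTameOrbit n p a μ M s₁ s₂ w) (hp : 1 < p)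
    (h₁₂ : s₁ ≤ s₂) : AbsolutelyContinuousOnInterval (Etot n p a μ w) s₁ s₂ := by
  have hM := (hw.tame s₁ (Set.left_mem_Icc.2 h₁₂)).nonneg
  refine (LipschitzOnWith.of_dist_le_mul (K := ⟨2 * (M * M) + M, by positivity⟩)
    fun s hs t ht => ?_).absolutelyContinuousOnInterval
  rw [Set.uIcc_of_le h₁₂] at hs ht
  rw [Real.dist_eq, Real.dist_eq]
  have h1 := hw.energy_sub_le_abs hp hs ht
  have h2 := hw.energy_sub_le_abs hp ht hs
  rw [abs_sub_comm t s] at h2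
  exact abs_sub_le_iff.2 ⟨h1, h2⟩

theorem deriv_energy_le (hw : IsTameOrbit n p a μ M s₁ s₂ w) (hp : 1 < p)
    (hs : s ∈ Set.Ioo s₁ s₂) (hE : DifferentiableAt ℝ (Etot n p a μ w) s) :
    deriv (Etot n p a μ w) s ≤ -(∫ y, velocity n p a μ w s y ^ 2 * rho n y) +
      ∫ y, timeForce p a μ s (w y s) * rho n y := by
  have hs' := Set.Ioo_subset_Icc_self hs
  have hslope := hE.hasDerivAt.tendsto_slope.mono_left
    (nhdsWithin_mono s (show Set.Iio s ⊆ {s}ᶜ from fun t ht => (Set.mem_Iio.1 ht).ne))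
  have hnear : ∀ᶠ t in 𝓝[<] s, t ∈ Set.Icc s₁ s₂ ∧ t < s :=
    Filter.inter_mem (mem_nhdsWithin_of_mem_nhds (Icc_mem_nhds hs.1 hs.2)) self_mem_nhdsWithin
  have hlim : Tendsto (fun t => ∫ y, (s - t)⁻¹ * increment n p a μ w s t y * rho n y) (𝓝[<] s)
      (𝓝 (∫ y, (-velocity n p a μ w s y ^ 2 + timeForce p a μ s (w y s)) * rho n y)) := by
    refine tendsto_integral_filter_of_dominated_convergence
      (fun y => (2 * (M * M) + M) * rho n y) ?_ ?_ ((integrable_rho n).const_mul _) ?_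
    · filter_upwards [hnear] with t ht
      simpa only [mul_assoc] using
        ((hw.integrable_increment hp hs' ht.1).const_mul _).aestronglyMeasurable
    · filter_upwards [hnear] with t ht
      refine Eventually.of_forall fun y => ?_
      have h0 : 0 < s - t := sub_pos.2 ht.2
      rw [norm_mul, norm_mul, Real.norm_of_nonneg (rho_pos n y).le,
        Real.norm_of_nonneg (inv_pos.2 h0).le]
      refine mul_le_mul_of_nonneg_right ?_ (rho_pos n y).le
      rw [inv_mul_le_iff₀ h0]
      have h1 := hw.abs_increment_le hp hs' ht.1 y
      rw [abs_of_pos h0] at h1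
      rw [Real.norm_eq_abs]
      linarith
    · refine Eventually.of_forall fun y => Tendsto.mul_const _ ?_
      have h1 := ((hw.hasDerivAt_potential hp hs' y).sub
        ((hw.hasDerivAt s hs' y).mul_const (ornstein n (fun z => w z s) y))).tendsto_slope.mono_left
        (nhdsWithin_mono s (show Set.Iio s ⊆ {s}ᶜ from fun t ht => (Set.mem_Iio.1 ht).ne))
      convert h1 using 2
      · rename_i t
        rw [slope_comm, slope_def_field, increment]
        simp only [Pi.sub_apply]
        rw [div_eq_inv_mul]
        ring
      · unfold velocity
        ring
  have hle := le_of_tendsto_of_tendsto hslope hlim (by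
    filter_upwards [hnear] with t ht
    have h0 : 0 < s - t := sub_pos.2 ht.2
    rw [slope_comm, slope_def_field, div_eq_inv_mul]
    simp_rw [mul_assoc]
    rw [integral_const_mul]
    exact mul_le_mul_of_nonneg_left (hw.energy_sub_le hp hs' ht.1) (inv_pos.2 h0).le)
  refine hle.trans_eq ?_
  have h1 : Integrable fun y => velocity n p a μ w s y ^ 2 * rho n y :=
    integrable_comp_mul_rho (continuous_pow 2) (hw.continuous_velocity hp hs')
      (hw.abs_velocity_le s hs')
  have h2 : Integrable fun y => timeForce p a μ s (w y s) * rho n y :=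
    integrable_mul_rho ((continuous_timeForce hp).comp
      (continuous_const.prodMk (hw.tame s hs').continuous)) (hw.abs_timeForce_le s hs')
  have h1' : Integrable fun y => -(velocity n p a μ w s y ^ 2 * rho n y) := h1.neg
  rw [← integral_neg, ← integral_add h1' h2]
  congr 1 with y
  ring

end IsTameOrbit

end Orbit

/-- Integration of a differential inequality; no regularity of `G` is needed because the interval
integral of a non-integrable function vanishes. -/
theorem AbsolutelyContinuousOnInterval.sub_le_neg_half_integral {J G : ℝ → ℝ} {a b : ℝ}
    (hJ : AbsolutelyContinuousOnInterval J a b) (hab : a ≤ b) (hG : ∀ s, 0 ≤ G s)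
    (h : ∀ s ∈ Set.Ioo a b, DifferentiableAt ℝ J s → deriv J s ≤ -(1 / 2) * G s) :
    J b - J a ≤ -(1 / 2) * ∫ s in a..b, G s := by
  have hae : ∀ᵐ s ∂volume.restrict (Set.Ioo a b), deriv J s ≤ -(1 / 2) * G s := by
    rw [ae_restrict_iff' measurableSet_Ioo]
    filter_upwards [hJ.ae_differentiableAt] with s hs hmem
    refine h s hmem (hs ?_)
    rw [Set.uIcc_of_le hab]
    exact Set.Ioo_subset_Icc_self hmem
  rw [restrict_Ioo_eq_restrict_Icc] at hae
  rw [← hJ.integral_deriv_eq_sub]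
  by_cases hint : IntervalIntegrable G volume a b
  · rw [← intervalIntegral.integral_const_mul]
    exact intervalIntegral.integral_mono_ae_restrict hab hJ.intervalIntegrable_deriv
      (hint.const_mul _) hae
  · rw [intervalIntegral.integral_undef hint, mul_zero, ← neg_nonneg,
      ← intervalIntegral.integral_neg]
    refine intervalIntegral.integral_nonneg_of_ae_restrict hab ?_
    filter_upwards [hae] with s hs
    have := hG s
    simp only [Pi.zero_apply]
    linarith

theorem IsTameOrbit.absolutelyContinuous_lyapunov {n : ℕ} {p a μ γ θ M s₁ s₂ : ℝ}
    {w : EuclideanSpace ℝ (Fin n) → ℝ → ℝ} (hw : IsTameOrbit n p a μ M s₁ s₂ w) (hp : 1 < p)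
    (hs₁ : 0 < s₁) (h₁₂ : s₁ ≤ s₂) :
    AbsolutelyContinuousOnInterval (Jfun n p a μ γ θ w) s₁ s₂ := by
  have hpow : ContDiffOn ℝ 1 (fun s : ℝ => s ^ (-a)) (Set.uIcc s₁ s₂) := by
    rw [Set.uIcc_of_le h₁₂]
    exact contDiffOn_id.rpow_const_of_ne fun s hs => (hs₁.trans_le hs.1).ne'
  exact ((hw.absolutelyContinuous_energy hp h₁₂).mul
    (contDiffOn_const.mul hpow).exp.absolutelyContinuousOnInterval).add
    (hpow.absolutelyContinuousOnInterval.const_mul θ)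

theorem deriv_lyapunov {n : ℕ} {p a μ γ θ s : ℝ} {w : EuclideanSpace ℝ (Fin n) → ℝ → ℝ}
    (ha : 0 < a) (hs : 0 < s) (hE : DifferentiableAt ℝ (Etot n p a μ w) s) :
    deriv (Jfun n p a μ γ θ w) s =
      Real.exp (γ / a * s ^ (-a)) *
          (deriv (Etot n p a μ w) s - γ * s ^ (-a - 1) * Etot n p a μ w s) -
        θ * a * s ^ (-a - 1) := by
  have h1 : HasDerivAt (fun s : ℝ => s ^ (-a)) (-a * s ^ (-a - 1)) s :=
    Real.hasDerivAt_rpow_const (Or.inl hs.ne')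
  have h2 := (hE.hasDerivAt.mul (h1.const_mul (γ / a)).exp).add (h1.const_mul θ)
  refine h2.deriv.trans ?_
  field_simp
  ring
/-- Existence of a Lyapunov functional for equation (W). -/
theorem stmt0 (n : ℕ) (hn : 1 ≤ n) (p : ℝ) (hp : 1 < p)
    (hpS : 3 ≤ n → p < ((n : ℝ) + 2) / ((n : ℝ) - 2)) (a : ℝ) (ha : 0 < a) (μ : ℝ) :
    ∃ sh > (0:ℝ), ∃ θh > (0:ℝ), ∃ γ > (0:ℝ), ∀ θ : ℝ, θh ≤ θ →
      ∀ s₀ : ℝ, ∀ w : EuclideanSpace ℝ (Fin n) → ℝ → ℝ,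
        SolvesW n p a μ s₀ w → BoundedW n s₀ w →
        ∀ s₁ s₂ : ℝ, max sh s₀ ≤ s₁ → s₁ < s₂ →
          Jfun n p a μ γ θ w s₂ - Jfun n p a μ γ θ w s₁ ≤
            -(1 / 2) * ∫ s in s₁..s₂, ∫ y, (deriv (fun s' => w y s') s) ^ 2 * rho n y := by
  obtain ⟨γ, hγ, C, hC, hprod⟩ := exists_energy_production_le n hp ha μ
  obtain ⟨T, hT⟩ := eventually_atTop.1 hprod
  refine ⟨max T 1, by positivity, C * Real.exp (γ / a) / a, by positivity, γ, hγ, ?_⟩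
  intro θ hθ s₀ w hw hb s₁ s₂ hs₁ h₁₂
  have hs₀ : s₀ ≤ s₁ := (le_max_right _ _).trans hs₁
  have hT₁ : max T 1 ≤ s₁ := (le_max_left _ _).trans hs₁
  have h1s : 1 ≤ s₁ := (le_max_right _ _).trans hT₁
  obtain ⟨M, hM⟩ := hw.exists_isTameOrbit hb hp hs₀ h₁₂
  refine (hM.absolutelyContinuous_lyapunov hp (by linarith) h₁₂.le).sub_le_neg_half_integral h₁₂.le
    (fun s => integral_nonneg fun y => mul_nonneg (sq_nonneg _) (rho_pos n y).le) fun s hs hJ => ?_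
  have hs' := Set.Ioo_subset_Icc_self hs
  have h1 : 1 ≤ s := h1s.trans hs'.1
  have hs0 : 0 < s := by linarith
  have hE : DifferentiableAt ℝ (Etot n p a μ w) s := by
    have h2 : DifferentiableAt ℝ (fun s : ℝ => s ^ (-a)) s :=
      (Real.hasDerivAt_rpow_const (Or.inl hs0.ne')).differentiableAt
    have h3 : Etot n p a μ w = fun s => (Jfun n p a μ γ θ w s - θ * s ^ (-a)) *
        Real.exp (-(γ / a * s ^ (-a))) := by
      ext r
      rw [Jfun, add_sub_cancel_right, mul_assoc, ← Real.exp_add, add_neg_cancel, Real.exp_zero,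
        mul_one]
    rw [h3]
    exact (hJ.sub (h2.const_mul θ)).mul (h2.const_mul (γ / a)).neg.exp
  have hbound := hT s ((le_max_left _ _).trans (hT₁.trans hs'.1)) M (fun y => w y s)
    (velocity n p a μ w s) (hM.tame s hs') (hM.continuous_velocity hp hs')
    (hM.abs_velocity_le s hs') fun y => rfl
  have hdE := hM.deriv_energy_le hp hs hE
  have heq : Etot n p a μ w s = profileEnergy n p a μ s (fun y => w y s) :=
    (hM.tame s hs').energy_eq hp s
  simp_rw [hw.deriv_eq (hs₀.trans hs'.1)]
  rw [deriv_lyapunov ha hs0 hE, heq]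
  set G := ∫ y, velocity n p a μ w s y ^ 2 * rho n y with hG
  have hG0 : 0 ≤ G := integral_nonneg fun y => mul_nonneg (sq_nonneg _) (rho_pos n y).le
  have hσ : 0 < s ^ (-a - 1) := by positivity
  have hφ : 1 ≤ Real.exp (γ / a * s ^ (-a)) := Real.one_le_exp (by positivity)
  have hφ' : Real.exp (γ / a * s ^ (-a)) ≤ Real.exp (γ / a) :=
    Real.exp_le_exp.2 (mul_le_of_le_one_right (by positivity)
      (Real.rpow_le_one_of_one_le_of_nonpos h1 (by linarith)))
  rw [div_le_iff₀ ha] at hθ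
  have h4 := mul_le_mul_of_nonneg_left (show deriv (Etot n p a μ w) s -
    γ * s ^ (-a - 1) * profileEnergy n p a μ s (fun y => w y s) ≤
      -(1 / 2) * G + C * s ^ (-a - 1) by linarith) (Real.exp_pos (γ / a * s ^ (-a))).le
  have h5 := mul_le_mul_of_nonneg_right hφ hG0
  have h6 := mul_le_mul_of_nonneg_right hφ' (show 0 ≤ C * s ^ (-a - 1) by positivity)
  have h7 := mul_le_mul_of_nonneg_right hθ hσ.le
  linarith
end

section
/- Let φ : [s₀, ∞) → (0, ∞) be a differentiable positive solution of φ'(s) = -φ/(p-1) + φ^p + e^{-ps/(p-1)} h(e^{s/(p-1)} φ) with φ(s) → κ as s → ∞. Fix l ∈ {1,…,n} and define, for y ∈ ℝⁿ and s > 0, ϕ(y,s) = (φ(s)/κ) [ κ (1 + ((p-1)/(4 p s)) Σ_{j=1}^l y_j²)^{-1/(p-1)} + κ l / (2 p s) ], and R(y,s) = -∂_s ϕ + Δϕ - (y/2)·∇ϕ - ϕ/(p-1) + ϕ^p + e^{-ps/(p-1)} h( e^{s/(p-1)} ϕ ). Then, with a' = min{1, a}, there exist C > 0 and s₁ ≥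 s₀ such that for all s ≥ s₁ and all y ∈ ℝⁿ: |R(y,s)| ≤ C (|y|² + 1) / s^{a' + 1}. -/
open Real Filter MeasureTheory

/-- The approximate profile
`ϕ(y,s) = (φ(s)/κ) [κ (1 + ((p-1)/(4ps)) Σ_{j<l} y_j²)^{-1/(p-1)} + κ l/(2ps)]`. -/
noncomputable def prof (n : ℕ) (p κ : ℝ) (l : ℕ) (φ : ℝ → ℝ)
    (y : EuclideanSpace ℝ (Fin n)) (s : ℝ) : ℝ :=
  (φ s / κ) *
    (κ * (1 + (p - 1) / (4 * p * s) *
        ∑ j ∈ Finset.univ.filter (fun j : Fin n => (j : ℕ) < l), (y j) ^ 2) ^ (-(1 / (p - 1)))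
      + κ * l / (2 * p * s))

/-- The error term
`R(y,s) = -∂ₛϕ + Δϕ - (y/2)·∇ϕ - ϕ/(p-1) + ϕ^p + e^{-ps/(p-1)} h(e^{s/(p-1)} ϕ)`. -/
noncomputable def Rterm (n : ℕ) (p a μ κ : ℝ) (l : ℕ) (φ : ℝ → ℝ)
    (y : EuclideanSpace ℝ (Fin n)) (s : ℝ) : ℝ :=
  -(deriv (fun s' => prof n p κ l φ y s') s) + lap n (fun z => prof n p κ l φ z s) y
    - (1 / 2) * fderiv ℝ (fun z => prof n p κ l φ z s) y y
    - prof n p κ l φ y s / (p - 1) + prof n p κ l φ y s ^ p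
    + Real.exp (-p * s / (p - 1)) * hfun p a μ (Real.exp (s / (p - 1)) * prof n p κ l φ y s)

open Asymptotics Topology

/-- The sum of the squares of the first `l` coordinates. -/
noncomputable def headSq (n l : ℕ) (y : EuclideanSpace ℝ (Fin n)) : ℝ :=
  ∑ j ∈ Finset.univ.filter (fun j : Fin n => (j : ℕ) < l), (y j) ^ 2

lemma headSq_nonneg (n l : ℕ) (y : EuclideanSpace ℝ (Fin n)) : 0 ≤ headSq n l y :=
  Finset.sum_nonneg fun _ _ => sq_nonneg _

lemma headSq_le_norm_sq (n l : ℕ) (y : EuclideanSpace ℝ (Fin n)) : headSq n l y ≤ ‖y‖ ^ 2 := by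
  rw [EuclideanSpace.real_norm_sq_eq]
  exact Finset.sum_le_sum_of_subset_of_nonneg (Finset.filter_subset _ _) fun _ _ _ => sq_nonneg _

lemma hasFDerivAt_headSq (n l : ℕ) (y : EuclideanSpace ℝ (Fin n)) :
    HasFDerivAt (headSq n l)
      (∑ j ∈ Finset.univ.filter (fun j : Fin n => (j : ℕ) < l),
        (2 * y j) • (EuclideanSpace.proj j : EuclideanSpace ℝ (Fin n) →L[ℝ] ℝ)) y := by
  unfold headSq
  refine HasFDerivAt.fun_sum fun j _ => ?_
  have h := ((EuclideanSpace.proj j : EuclideanSpace ℝ (Fin n) →L[ℝ] ℝ).hasFDerivAt (x := y)).pow 2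
  simpa using h

lemma hasFDerivAt_rpow_headSq (n l : ℕ) {c : ℝ} (hc : 0 ≤ c) (r : ℝ)
    (y : EuclideanSpace ℝ (Fin n)) :
    HasFDerivAt (fun z => (1 + c * headSq n l z) ^ r)
      ((r * (1 + c * headSq n l y) ^ (r - 1) * c) •
        ∑ j ∈ Finset.univ.filter (fun j : Fin n => (j : ℕ) < l),
        (2 * y j) • (EuclideanSpace.proj j : EuclideanSpace ℝ (Fin n) →L[ℝ] ℝ)) y := by
  have h0 : 0 < 1 + c * headSq n l y := by
    have := mul_nonneg hc (headSq_nonneg n l y); linarith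
  have h := (((hasFDerivAt_headSq n l y).const_mul c).const_add 1).rpow_const (p := r)
    (Or.inl h0.ne')
  rwa [smul_smul] at h

lemma prof_eq {n : ℕ} {p κ : ℝ} (hκ : κ ≠ 0) (l : ℕ) (φ : ℝ → ℝ) (y : EuclideanSpace ℝ (Fin n))
    (s : ℝ) : prof n p κ l φ y s = φ s *
      ((1 + (p - 1) / (4 * p * s) * headSq n l y) ^ (-(1 / (p - 1))) + l / (2 * p * s)) := by
  unfold prof headSq
  field_simp

lemma fderiv_prof {n : ℕ} {p κ : ℝ} (hp : 1 < p) (hκ : κ ≠ 0) (l : ℕ) (φ : ℝ → ℝ) {s : ℝ}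
    (hs : 0 < s) (y v : EuclideanSpace ℝ (Fin n)) :
    fderiv ℝ (fun z => prof n p κ l φ z s) y v =
      φ s * (-(1 / (p - 1)) * (1 + (p - 1) / (4 * p * s) * headSq n l y) ^ (-(1 / (p - 1)) - 1) *
        ((p - 1) / (4 * p * s))) *
        ∑ j ∈ Finset.univ.filter (fun j : Fin n => (j : ℕ) < l), 2 * y j * v j := by
  have hc : 0 ≤ (p - 1) / (4 * p * s) := div_nonneg (by linarith) (by positivity)
  have h := ((hasFDerivAt_rpow_headSq n l hc (-(1 / (p - 1))) y).add_const
    ((l : ℝ) / (2 * p * s))).const_mul (φ s)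
  have he : (fun z => prof n p κ l φ z s) = fun z => φ s *
      ((1 + (p - 1) / (4 * p * s) * headSq n l z) ^ (-(1 / (p - 1))) + l / (2 * p * s)) :=
    funext fun z => prof_eq hκ l φ z s
  rw [he, h.fderiv]
  simp [mul_assoc, sum_apply]

lemma fderiv_prof_self {n : ℕ} {p κ : ℝ} (hp : 1 < p) (hκ : κ ≠ 0) (l : ℕ) (φ : ℝ → ℝ) {s : ℝ}
    (hs : 0 < s) (y : EuclideanSpace ℝ (Fin n)) :
    fderiv ℝ (fun z => prof n p κ l φ z s) y y =
      φ s * (-(1 / (p - 1)) * (1 + (p - 1) / (4 * p * s) * headSq n l y) ^ (-(1 / (p - 1)) - 1) *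
        ((p - 1) / (4 * p * s))) * (2 * headSq n l y) := by
  rw [fderiv_prof hp hκ l φ hs]
  congr 1
  rw [headSq, Finset.mul_sum]
  exact Finset.sum_congr rfl fun j _ => by ring

lemma fderiv_fderiv_prof_single {n : ℕ} {p κ : ℝ} (hp : 1 < p) (hκ : κ ≠ 0) (l : ℕ) (φ : ℝ → ℝ)
    {s : ℝ} (hs : 0 < s) (y : EuclideanSpace ℝ (Fin n)) (i : Fin n) :
    fderiv ℝ (fun z => fderiv ℝ (fun z => prof n p κ l φ z s) z (EuclideanSpace.single i 1)) y
      (EuclideanSpace.single i 1) =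
      if (i : ℕ) < l then
        φ s * (-(1 / (p - 1)) * ((p - 1) / (4 * p * s))) *
          ((-(1 / (p - 1)) - 1) * (1 + (p - 1) / (4 * p * s) * headSq n l y) ^
            (-(1 / (p - 1)) - 1 - 1) * ((p - 1) / (4 * p * s)) * (4 * y i ^ 2)
          + 2 * (1 + (p - 1) / (4 * p * s) * headSq n l y) ^ (-(1 / (p - 1)) - 1))
      else 0 := by
  have hc : 0 ≤ (p - 1) / (4 * p * s) := div_nonneg (by linarith) (by positivity)
  have he : (fun z => fderiv ℝ (fun z => prof n p κ l φ z s) z (EuclideanSpace.single i 1)) =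
      fun z => if (i : ℕ) < l then (φ s * (-(1 / (p - 1)) * ((p - 1) / (4 * p * s)))) *
        ((1 + (p - 1) / (4 * p * s) * headSq n l z) ^ (-(1 / (p - 1)) - 1) * (2 * z i)) else 0 := by
    funext z
    rw [fderiv_prof hp hκ l φ hs]
    split_ifs with hi
    · simp [hi]
      ring
    · simp [hi]
  rw [he]
  split_ifs with hi
  · have h1 := hasFDerivAt_rpow_headSq n l hc (-(1 / (p - 1)) - 1) y
    have h2 := ((EuclideanSpace.proj i : EuclideanSpace ℝ (Fin n) →L[ℝ] ℝ).hasFDerivAt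
      (x := y)).const_mul 2
    have h := (h1.mul h2).const_mul (φ s * (-(1 / (p - 1)) * ((p - 1) / (4 * p * s))))
    have h' := h.fderiv
    simp only [PiLp.proj_apply] at h'
    erw [h']
    simp [sum_apply, hi]
    ring
  · simp

lemma card_filter_val_lt {n l : ℕ} (hl : l ≤ n) :
    (Finset.univ.filter (fun j : Fin n => (j : ℕ) < l)).card = l := by
  simp [Fin.card_filter_val_lt, hl]

lemma lap_prof {n : ℕ} {p κ : ℝ} (hp : 1 < p) (hκ : κ ≠ 0) {l : ℕ} (hl : l ≤ n) (φ : ℝ → ℝ)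
    {s : ℝ} (hs : 0 < s) (y : EuclideanSpace ℝ (Fin n)) :
    lap n (fun z => prof n p κ l φ z s) y =
      φ s * (-(1 / (p - 1)) * ((p - 1) / (4 * p * s))) *
        ((-(1 / (p - 1)) - 1) * (1 + (p - 1) / (4 * p * s) * headSq n l y) ^
          (-(1 / (p - 1)) - 1 - 1) * ((p - 1) / (4 * p * s)) * (4 * headSq n l y)
        + 2 * l * (1 + (p - 1) / (4 * p * s) * headSq n l y) ^ (-(1 / (p - 1)) - 1)) := by
  unfold lap
  simp_rw [fderiv_fderiv_prof_single hp hκ l φ hs y]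
  rw [← Finset.sum_filter, ← Finset.mul_sum, Finset.sum_add_distrib, ← Finset.mul_sum,
    ← Finset.mul_sum, Finset.sum_const, card_filter_val_lt hl, headSq, nsmul_eq_mul]
  ring

lemma deriv_prof {n : ℕ} {p κ : ℝ} (hp : 1 < p) (hκ : κ ≠ 0) (l : ℕ) {φ : ℝ → ℝ} {φ' s : ℝ}
    (hs : 0 < s) (hφ : HasDerivAt φ φ' s) (y : EuclideanSpace ℝ (Fin n)) :
    deriv (fun s' => prof n p κ l φ y s') s =
      φ' * ((1 + (p - 1) / (4 * p * s) * headSq n l y) ^ (-(1 / (p - 1))) + l / (2 * p * s))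
      + φ s * (1 / (p - 1) * (1 + (p - 1) / (4 * p * s) * headSq n l y) ^ (-(1 / (p - 1)) - 1) *
        ((p - 1) / (4 * p * s) * headSq n l y / s) - l / (2 * p * s) / s) := by
  have h0 : 0 < 1 + (p - 1) / (4 * p * s) * headSq n l y := by
    have : 0 ≤ (p - 1) / (4 * p * s) := div_nonneg (by linarith) (by positivity)
    have := mul_nonneg this (headSq_nonneg n l y)
    linarith
  have hdiv : ∀ c d : ℝ, d ≠ 0 → HasDerivAt (fun t : ℝ => c / (d * t)) (-(c / (d * s) / s)) s := by
    intro c d hd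
    have h := (((hasDerivAt_id s).const_mul d).inv (mul_ne_zero hd hs.ne')).const_mul c
    refine (h.congr_deriv ?_).congr_of_eventuallyEq (Eventually.of_forall fun t => ?_)
    · simp only [id]
      field_simp
    · simp [div_eq_mul_inv]
  have h1 := (((hdiv (p - 1) (4 * p) (by positivity)).mul_const (headSq n l y)).const_add
    1).rpow_const (p := -(1 / (p - 1))) (Or.inl h0.ne')
  have h := hφ.mul (h1.add (hdiv l (2 * p) (by positivity)))
  have he : (fun s' => prof n p κ l φ y s') = fun t => φ t *
      ((1 + (p - 1) / (4 * p * t) * headSq n l y) ^ (-(1 / (p - 1))) + l / (2 * p * t)) :=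
    funext fun t => prof_eq hκ l φ y t
  rw [he]
  refine Eq.trans h.deriv ?_
  simp only [Pi.add_apply]
  ring

/-- The nonlinearity `h` written in similarity variables. -/
noncomputable def rescaledH (p a μ s z : ℝ) : ℝ :=
  Real.exp (-p * s / (p - 1)) * hfun p a μ (Real.exp (s / (p - 1)) * z)

lemma rescaledH_eq {p : ℝ} (hp : 1 < p) (a μ s : ℝ) {z : ℝ} (hz : 0 < z) :
    rescaledH p a μ s z =
      μ * z ^ p * (Real.log (2 + (Real.exp (s / (p - 1)) * z) ^ 2)) ^ (-a) := by
  have hp' : p - 1 ≠ 0 := by linarith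
  have hE := Real.exp_pos (s / (p - 1))
  have hlog : 0 ≤ Real.log (2 + (Real.exp (s / (p - 1)) * z) ^ 2) :=
    Real.log_nonneg (by nlinarith [sq_nonneg (Real.exp (s / (p - 1)) * z)])
  unfold rescaledH hfun
  rw [abs_of_pos (mul_pos hE hz), Real.mul_rpow hE.le hz.le, ← Real.exp_mul,
    div_mul_cancel₀ _ hp', Real.rpow_neg hlog]
  have h1 : Real.exp (-p * s / (p - 1)) * Real.exp s * Real.exp (s / (p - 1)) = 1 := by
    rw [← Real.exp_add, ← Real.exp_add, Real.exp_eq_one_iff]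
    field_simp
    ring
  have h2 : z ^ (p - 1) * z = z ^ p := by
    rw [Real.rpow_sub_one hz.ne', div_mul_cancel₀ _ hz.ne']
  linear_combination (μ * (z ^ (p - 1) * z) *
    (Real.log (2 + (Real.exp (s / (p - 1)) * z) ^ 2) ^ a)⁻¹) * h1 +
    μ * (Real.log (2 + (Real.exp (s / (p - 1)) * z) ^ 2) ^ a)⁻¹ * h2

lemma Rterm_eq {n : ℕ} {p κ : ℝ} (hp : 1 < p) (hκ : κ ≠ 0) (a μ : ℝ) {l : ℕ} (hl : l ≤ n)
    {φ : ℝ → ℝ} {s : ℝ} (hs : 0 < s) (hφ0 : 0 < φ s)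
    (hφ : HasDerivAt φ (-(φ s) / (p - 1) + φ s ^ p + rescaledH p a μ s (φ s)) s)
    (y : EuclideanSpace ℝ (Fin n)) {x u ε : ℝ}
    (hx : x = (p - 1) / (4 * p * s) * headSq n l y) (hu : u = (1 + x) ^ (-(1 / (p - 1))))
    (hε : ε = l / (2 * p * s)) :
    Rterm n p a μ κ l φ y s =
      φ s * (-(1 / (p - 1) * u ^ p * (x / s)) + ε / s +
        1 / (p - 1) * (1 + x) ^ (-(1 / (p - 1)) - 1 - 1) * (x / s))
      + φ s * (1 / (p - 1)) * ((u + ε) ^ p - u ^ p - p * ε * u ^ (p - 1))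
      + φ s * ε * (1 / (p - 1) * p * u ^ (p - 1) - 1 / (p - 1) - u ^ p)
      + φ s * (φ s ^ (p - 1) - 1 / (p - 1)) * ((u + ε) ^ p - (u + ε))
      + (rescaledH p a μ s (φ s * (u + ε)) - (u + ε) * rescaledH p a μ s (φ s)) := by
  have hp' : p - 1 ≠ 0 := by linarith
  have hβ : 0 ≤ (p - 1) / (4 * p * s) := div_nonneg (by linarith) (by positivity)
  have hx0 : 0 ≤ x := hx ▸ mul_nonneg hβ (headSq_nonneg n l y)
  have hA : 0 < 1 + x := by linarith
  have hu0 : 0 < u := hu ▸ Real.rpow_pos_of_pos hA _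
  have hε0 : 0 ≤ ε := hε ▸ by positivity
  have hup : (1 + x) ^ (-(1 / (p - 1)) - 1) = u ^ p := by
    rw [hu, ← Real.rpow_mul hA.le]
    congr 1
    field_simp
    ring
  have huA : u ^ p * (1 + x) = u := by
    rw [← hup, Real.rpow_sub_one hA.ne', div_mul_cancel₀ _ hA.ne', hu]
  have hφp : φ s ^ (p - 1) * φ s = φ s ^ p := by
    rw [Real.rpow_sub_one hφ0.ne', div_mul_cancel₀ _ hφ0.ne']
  have hmul : (φ s * (u + ε)) ^ p = φ s ^ p * (u + ε) ^ p :=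
    Real.mul_rpow hφ0.le (by positivity)
  have hlε : 2 * (1 / (p - 1) * ((p - 1) / (4 * p * s))) * l = ε := by
    rw [hε]; field_simp; ring
  have hα : 4 * (1 / (p - 1) * ((p - 1) / (4 * p * s))) * (1 / (p - 1) + 1) = 1 / (p - 1) / s := by
    field_simp; ring
  unfold Rterm
  rw [lap_prof hp hκ hl φ hs, fderiv_prof_self hp hκ l φ hs, deriv_prof hp hκ l hs hφ,
    prof_eq hκ, ← hx, ← hε, ← hu, hup, hmul, ← rescaledH]
  generalize (1 + x) ^ (-(1 / (p - 1)) - 1 - 1) = t at *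
  generalize (p - 1) / (4 * p * s) = β at *
  generalize headSq n l y = Q at *
  generalize rescaledH p a μ s (φ s * (u + ε)) = H1
  generalize rescaledH p a μ s (φ s) = H2
  generalize u ^ p = v at *
  generalize (u + ε) ^ p = wp at *
  generalize u ^ (p - 1) = um at *
  generalize φ s ^ p = fp at *
  generalize φ s ^ (p - 1) = fm at *
  rw [div_eq_mul_one_div (-φ s), div_eq_mul_one_div (φ s * (u + ε))]
  generalize 1 / (p - 1) = α at *
  subst hx
  linear_combination (φ s) * α * huA + (-wp + (u + ε)) * hφp - φ s * v * hlε + φ s * t * (β * Q) * hα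

lemma eventually_le_log {p c : ℝ} (hp : 1 < p) (hc : 0 < c) :
    ∀ᶠ s in atTop, ∀ z, c / s ≤ z →
      s / (p - 1) ≤ Real.log (2 + (Real.exp (s / (p - 1)) * z) ^ 2) := by
  have hp' : 0 < p - 1 := by linarith
  have h := (tendsto_exp_mul_div_rpow_atTop 2 (1 / (p - 1)) (by positivity)).eventually_ge_atTop
    (1 / c ^ 2)
  filter_upwards [h, eventually_gt_atTop 0] with s hs hs0 z hz
  rw [Real.rpow_two, one_div_mul_eq_div] at hs
  have hcz : (c / s) ^ 2 ≤ z ^ 2 := pow_le_pow_left₀ (by positivity) hz 2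
  have hE := Real.exp_pos (s / (p - 1))
  have h1 : 1 ≤ Real.exp (s / (p - 1)) * (c / s) ^ 2 := by
    rw [div_le_div_iff₀ (by positivity) (by positivity)] at hs
    rw [div_pow, ← mul_div_assoc, le_div_iff₀ (by positivity)]
    exact hs
  rw [Real.le_log_iff_exp_le (by positivity), mul_pow]
  have h2 : 1 ≤ Real.exp (s / (p - 1)) * z ^ 2 := h1.trans (by gcongr)
  nlinarith

/-- If `v` tends to `0` and increases wherever it exceeds a nonnegative nonincreasing barrier,
then it stays below the barrier. -/
lemma le_barrier_of_tendsto_zero {v v' B : ℝ → ℝ} {S : ℝ}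
    (hd : ∀ s, S ≤ s → HasDerivAt v (v' s) s) (hB : AntitoneOn B (Set.Ici S))
    (hB0 : ∀ s, S ≤ s → 0 ≤ B s) (hlim : Tendsto v atTop (𝓝 0))
    (hpos : ∀ s, S ≤ s → B s < v s → 0 < v' s) : ∀ s, S ≤ s → v s ≤ B s := by
  intro t ht
  by_contra! hlt
  have hvt : 0 < v t := (hB0 t ht).trans_lt hlt
  obtain ⟨T, hT⟩ := eventually_atTop.1 (hlim.eventually_lt_const hvt)
  have hcont : ContinuousOn v (Set.Icc t (max t T)) := fun x hx =>
    (hd x (ht.trans hx.1)).continuousAt.continuousWithinAt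
  obtain ⟨m, hm, hmax⟩ := isCompact_Icc.exists_isMaxOn ⟨t, le_rfl, le_max_left t T⟩ hcont
  have hmt : v t ≤ v m := hmax ⟨le_rfl, le_max_left t T⟩
  have hSm : S ≤ m := ht.trans hm.1
  have hmB : B m < v m := ((hB ht hSm hm.1).trans_lt hlt).trans_le hmt
  have hslope := (hasDerivAt_iff_tendsto_slope.1 (hd m hSm)).eventually_const_lt (hpos m hSm hmB)
  obtain ⟨x, hx, hxm⟩ := ((hslope.filter_mono
    (nhdsWithin_mono m fun x (hx : x ∈ Set.Ioi m) => ne_of_gt hx)).and self_mem_nhdsWithin).exists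
  have hxm' : m < x := hxm
  have hvx : v m < v x := by
    rw [slope_def_field] at hx
    have := (div_pos_iff_of_pos_right (sub_pos.2 hxm')).1 hx
    linarith
  by_cases hxT : x ≤ max t T
  · exact absurd (hmax ⟨hm.1.trans hxm'.le, hxT⟩) (not_le.2 hvx)
  · have := hT x ((le_max_right t T).trans (not_le.1 hxT).le)
    linarith

lemma rescaledH_isBigO {p κ : ℝ} (hp : 1 < p) (hκ : 0 < κ) {a : ℝ} (ha : 0 < a) (μ : ℝ)
    {φ : ℝ → ℝ} (hlim : Tendsto φ atTop (𝓝 κ)) :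
    (fun s => rescaledH p a μ s (φ s)) =O[atTop] fun s => s ^ (-a) := by
  have hp' : 0 < p - 1 := by linarith
  refine IsBigO.of_bound (|μ| * (2 * κ) ^ p * (1 / (p - 1)) ^ (-a)) ?_
  filter_upwards [eventually_le_log hp (half_pos hκ), eventually_ge_atTop 1,
    hlim.eventually_const_lt (half_lt_self hκ), hlim.eventually_lt_const (show κ < 2 * κ by linarith)]
    with s hlog hs h1 h2
  have hs0 : 0 < s := by linarith
  have hφ0 : 0 < φ s := (half_pos hκ).trans h1
  have hL := hlog (φ s) ((div_le_self (half_pos hκ).le hs).trans h1.le)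
  rw [rescaledH_eq hp a μ s hφ0, norm_mul, norm_mul, Real.norm_eq_abs, Real.norm_eq_abs,
    Real.norm_eq_abs, Real.norm_eq_abs, abs_of_pos (Real.rpow_pos_of_pos hφ0 p),
    abs_of_pos (Real.rpow_pos_of_pos hs0 _),
    abs_of_nonneg (Real.rpow_nonneg ((by positivity : 0 ≤ s / (p - 1)).trans hL) _),
    mul_assoc _ _ (s ^ (-a)),
    ← Real.mul_rpow (by positivity) hs0.le, one_div_mul_eq_div]
  have hφp : φ s ^ p ≤ (2 * κ) ^ p := Real.rpow_le_rpow hφ0.le h2.le (by linarith)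
  have hLa := Real.rpow_le_rpow_of_nonpos (by positivity) hL (neg_nonpos.2 ha.le)
  gcongr
  exact Real.rpow_nonneg ((by positivity : 0 ≤ s / (p - 1)).trans hL) _

lemma kappa_rpow_sub_one {p κ : ℝ} (hp : 1 < p) (hκ : κ = (p - 1) ^ (-(1 / (p - 1)))) :
    κ ^ (p - 1) = 1 / (p - 1) := by
  have hp' : 0 < p - 1 := by linarith
  rw [hκ, ← Real.rpow_mul hp'.le, neg_mul, one_div_mul_cancel hp'.ne', Real.rpow_neg_one, one_div]

/-- The solution of the rescaled ODE converges to its limit at the rate of the forcing term. -/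
lemma sub_kappa_isBigO {p κ : ℝ} (hp : 1 < p) (hκ0 : 0 < κ) (hκ : κ ^ (p - 1) = 1 / (p - 1))
    {a : ℝ} (ha : 0 < a) {f φ : ℝ → ℝ} {s₀ : ℝ}
    (hode : ∀ s, s₀ ≤ s → HasDerivAt φ (-(φ s) / (p - 1) + φ s ^ p + f s) s)
    (hlim : Tendsto φ atTop (𝓝 κ)) (hf : f =O[atTop] fun s => s ^ (-a)) :
    (fun s => φ s - κ) =O[atTop] fun s => s ^ (-a) := by
  have hp' : 0 < p - 1 := by linarith
  have hF : HasDerivAt (fun z : ℝ => -z / (p - 1) + z ^ p) 1 κ := by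
    have h1 := ((hasDerivAt_id κ).neg.div_const (p - 1)).add
      (Real.hasDerivAt_rpow_const (x := κ) (p := p) (Or.inl hκ0.ne'))
    refine h1.congr_deriv ?_
    rw [hκ]
    field_simp
    ring
  have hF0 : -κ / (p - 1) + κ ^ p = 0 := by
    have : κ ^ p = κ ^ (p - 1) * κ := by rw [Real.rpow_sub_one hκ0.ne', div_mul_cancel₀ _ hκ0.ne']
    rw [this, hκ]
    ring
  have hlo := ((hasDerivAt_iff_isLittleO.1 hF).comp_tendsto hlim).def (half_pos one_pos)
  obtain ⟨M, hM, hfM⟩ := hf.exists_pos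
  obtain ⟨S, hS⟩ := eventually_atTop.1 (hlo.and hfM.bound)
  have hbound : ∀ s, max (max S s₀) 1 ≤ s → S ≤ s ∧ s₀ ≤ s ∧ 1 ≤ s := fun s hs =>
    ⟨(le_max_left _ _).trans ((le_max_left _ _).trans hs),
      (le_max_right _ _).trans ((le_max_left _ _).trans hs), (le_max_right _ _).trans hs⟩
  have key : ∀ s, max (max S s₀) 1 ≤ s →
      |(-(φ s) / (p - 1) + φ s ^ p) - (φ s - κ)| ≤ 1 / 2 * |φ s - κ| ∧ |f s| ≤ M * s ^ (-a) := by
    intro s hs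
    obtain ⟨hs1, -, hs3⟩ := hbound s hs
    obtain ⟨h1, h2⟩ := hS s hs1
    simp only [Function.comp, smul_eq_mul, mul_one, hF0, sub_zero, Real.norm_eq_abs] at h1 h2
    rw [abs_of_nonneg (Real.rpow_nonneg (by linarith) (-a) : 0 ≤ s ^ (-a))] at h2
    exact ⟨h1, h2⟩
  have hanti : AntitoneOn (fun s : ℝ => 2 * M * s ^ (-a)) (Set.Ici (max (max S s₀) 1)) := by
    intro s hs t ht hst
    have hs3 := (hbound s hs).2.2
    exact mul_le_mul_of_nonneg_left (Real.rpow_le_rpow_of_nonpos (by linarith) hst (by linarith))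
      (by positivity)
  have hB0 : ∀ s, max (max S s₀) 1 ≤ s → 0 ≤ 2 * M * s ^ (-a) := fun s hs => by
    have hs3 := (hbound s hs).2.2
    positivity
  have hlim0 : Tendsto (fun s => φ s - κ) atTop (𝓝 0) := by
    simpa using hlim.sub_const κ
  have hup := le_barrier_of_tendsto_zero
    (fun s hs => (hode s (hbound s hs).2.1).sub_const κ) hanti hB0 hlim0 (fun s hs hlt => by
      obtain ⟨h1, h2⟩ := key s hs
      have h0 := hB0 s hs
      rw [abs_of_pos (h0.trans_lt hlt)] at h1
      have := abs_le.1 h1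
      have := abs_le.1 h2
      linarith)
  have hdown := le_barrier_of_tendsto_zero (v := fun s => -(φ s - κ))
    (fun s hs => ((hode s (hbound s hs).2.1).sub_const κ).neg) hanti hB0
    (by simpa using hlim0.neg) (fun s hs hlt => by
      obtain ⟨h1, h2⟩ := key s hs
      have h0 := hB0 s hs
      rw [← abs_neg (φ s - κ), abs_of_pos (h0.trans_lt hlt)] at h1
      have := abs_le.1 h1
      have := abs_le.1 h2
      linarith)
  refine IsBigO.of_bound (2 * M) ?_
  filter_upwards [eventually_ge_atTop (max (max S s₀) 1)] with s hs
  have hs3 := (hbound s hs).2.2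
  rw [Real.norm_eq_abs, Real.norm_eq_abs, abs_of_nonneg (by positivity : 0 ≤ s ^ (-a)), abs_le]
  have := hup s hs
  have := hdown s hs
  constructor <;> linarith

lemma one_sub_mul_le_one_add_rpow_neg {x q : ℝ} (hx : 0 ≤ x) (hq : 0 ≤ q) :
    1 - q * x ≤ (1 + x) ^ (-q) := by
  have h1 := Real.log_le_sub_one_of_pos (show 0 < 1 + x by linarith)
  have h2 := Real.add_one_le_exp (Real.log (1 + x) * -q)
  rw [Real.rpow_def_of_pos (by linarith)]
  nlinarith

lemma abs_rpow_add_sub_le {p u ε : ℝ} (hp : 1 < p) (hu : 0 < u) (hε : 0 < ε) :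
    |(u + ε) ^ p - u ^ p - p * ε * u ^ (p - 1)| ≤
      p * ε * ((u + ε) ^ (p - 1) - u ^ (p - 1)) := by
  obtain ⟨c, hc, hslope⟩ := exists_hasDerivAt_eq_slope (fun z : ℝ => z ^ p)
    (fun z => p * z ^ (p - 1)) (show u < u + ε by linarith)
    (fun z hz => (Real.continuousAt_rpow_const z p
      (Or.inl (by have := hz.1; linarith))).continuousWithinAt)
    (fun z hz => Real.hasDerivAt_rpow_const (Or.inl (by have := hz.1; linarith)))
  rw [eq_div_iff (by linarith), add_sub_cancel_left] at hslope
  have h1 : u ^ (p - 1) ≤ c ^ (p - 1) := Real.rpow_le_rpow hu.le hc.1.le (by linarith)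
  have h2 : c ^ (p - 1) ≤ (u + ε) ^ (p - 1) :=
    Real.rpow_le_rpow (hu.trans hc.1).le hc.2.le (by linarith)
  have hpε : 0 < p * ε := by positivity
  rw [← hslope, show p * c ^ (p - 1) * ε - p * ε * u ^ (p - 1) =
    p * ε * (c ^ (p - 1) - u ^ (p - 1)) by ring, abs_of_nonneg
    (mul_nonneg hpε.le (sub_nonneg.2 h1))]
  gcongr

lemma abs_rpow_neg_sub_le {a m L₁ L₂ : ℝ} (ha : 0 < a) (hm : 0 < m) (h₁ : m ≤ L₁) (h₂ : m ≤ L₂) :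
    |L₁ ^ (-a) - L₂ ^ (-a)| ≤ a * m ^ (-a - 1) * |L₁ - L₂| := by
  have h := (convex_Ici m).norm_image_sub_le_of_norm_hasDerivWithin_le
    (f := fun z : ℝ => z ^ (-a)) (f' := fun z => -a * z ^ (-a - 1)) (C := a * m ^ (-a - 1))
    (fun z hz => (Real.hasDerivAt_rpow_const
      (Or.inl (hm.trans_le hz).ne')).hasDerivWithinAt)
    (fun z hz => by
      have hz0 : 0 < z := hm.trans_le hz
      rw [norm_mul, norm_neg, Real.norm_eq_abs, Real.norm_eq_abs, abs_of_pos ha,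
        abs_of_pos (Real.rpow_pos_of_pos hz0 _)]
      exact mul_le_mul_of_nonneg_left
        (Real.rpow_le_rpow_of_nonpos hm hz (by linarith)) ha.le) h₂ h₁
  simpa [Real.norm_eq_abs] using h

lemma abs_log_two_add_sub_le {X w : ℝ} (hX : 0 ≤ X) (hw : 0 < w) :
    |Real.log (2 + X * w ^ 2) - Real.log (2 + X)| ≤ 2 * |Real.log w| := by
  have hlog : Real.log (w ^ 2 * (2 + X)) = 2 * Real.log w + Real.log (2 + X) := by
    rw [Real.log_mul (by positivity) (by positivity), Real.log_pow]
    norm_num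
  rcases le_total 1 w with h | h
  · have hw2 : 1 ≤ w ^ 2 := one_le_pow₀ h
    have h1 := Real.log_le_log (by positivity) (show 2 + X ≤ 2 + X * w ^ 2 by nlinarith)
    have h2 := Real.log_le_log (by positivity) (show 2 + X * w ^ 2 ≤ w ^ 2 * (2 + X) by nlinarith)
    rw [abs_of_nonneg (Real.log_nonneg h), abs_le]
    constructor <;> linarith
  · have hw2 : w ^ 2 ≤ 1 := pow_le_one₀ hw.le h
    have h1 := Real.log_le_log (by positivity) (show 2 + X * w ^ 2 ≤ 2 + X by nlinarith)
    have h2 := Real.log_le_log (by positivity) (show w ^ 2 * (2 + X) ≤ 2 + X * w ^ 2 by nlinarith)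
    rw [abs_of_nonpos (Real.log_nonpos hw.le h), abs_le]
    constructor <;> linarith

lemma rpow_mul_abs_log_le {p w W : ℝ} (hp : 1 ≤ p) (hw : 0 < w) (hW : 1 ≤ W) (hwW : w ≤ W) :
    w ^ p * |Real.log w| ≤ W ^ p * |w - 1| := by
  rcases le_total 1 w with h | h
  · rw [abs_of_nonneg (Real.log_nonneg h), abs_of_nonneg (by linarith)]
    exact mul_le_mul (Real.rpow_le_rpow hw.le hwW (by linarith)) (Real.log_le_sub_one_of_pos hw)
      (Real.log_nonneg h) (by positivity)
  · rw [abs_of_nonpos (Real.log_nonpos hw.le h), abs_of_nonpos (by linarith)]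
    have h1 : w ^ p ≤ w := by
      simpa using Real.rpow_le_rpow_of_exponent_ge hw h hp
    have h2 : 1 - 1 / w ≤ Real.log w := by
      simpa using Real.one_sub_inv_le_log_of_pos hw
    have h3 : w * -Real.log w ≤ 1 - w := by
      have := mul_le_mul_of_nonneg_left h2 hw.le
      rw [mul_sub, mul_one_div_cancel hw.ne'] at this
      linarith
    calc w ^ p * -Real.log w ≤ w * -Real.log w :=
          mul_le_mul_of_nonneg_right h1 (neg_nonneg.2 (Real.log_nonpos hw.le h))
      _ ≤ 1 * (1 - w) := by linarith
      _ ≤ W ^ p * -(w - 1) := by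
          rw [neg_sub]
          exact mul_le_mul_of_nonneg_right (Real.one_le_rpow hW (by linarith)) (by linarith)

lemma add_rpow_sub_one_isBigO {ι : Type*} {F : Filter ι} {u ε D : ι → ℝ} {r : ℝ} (hr : 0 ≤ r)
    (hu : ∀ᶠ q in F, 0 < u q ∧ u q ≤ 1) (hε0 : ∀ᶠ q in F, 0 < ε q) (hε : Tendsto ε F (𝓝 0))
    (hεD : ε =O[F] D) (huD : (fun q => 1 - u q ^ r) =O[F] D) :
    (fun q => (u q + ε q) ^ r - 1) =O[F] D := by
  have h1 : (fun q => (1 + ε q) ^ r - 1) =O[F] D := by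
    have hd : HasDerivAt (fun z : ℝ => (1 + z) ^ r) (r * 1 ^ (r - 1)) 0 := by
      have h := (Real.hasDerivAt_rpow_const (x := 1 + 0) (p := r)
        (Or.inl (by norm_num))).comp_const_add 1 0
      simpa using h
    have h := hd.differentiableAt.isBigO_sub.comp_tendsto hε
    simp only [Function.comp_def, add_zero, Real.one_rpow, sub_zero] at h
    exact h.trans hεD
  refine IsBigO.trans (IsBigO.of_bound 1 ?_) (h1.norm_left.add huD.norm_left)
  filter_upwards [hu, hε0] with q ⟨hu0, hu1⟩ he
  have h2 : (u q + ε q) ^ r ≤ (1 + ε q) ^ r :=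
    Real.rpow_le_rpow (by positivity) (by linarith) hr
  have h3 : u q ^ r ≤ (u q + ε q) ^ r := Real.rpow_le_rpow hu0.le (by linarith) hr
  have h4 : 0 ≤ |(1 + ε q) ^ r - 1| + |1 - u q ^ r| := by positivity
  simp only [Real.norm_eq_abs, one_mul]
  rw [abs_of_nonneg h4, abs_le]
  have := le_abs_self ((1 + ε q) ^ r - 1)
  have := le_abs_self (1 - u q ^ r)
  have := abs_nonneg ((1 + ε q) ^ r - 1)
  have := abs_nonneg (1 - u q ^ r)
  constructor <;> linarith

lemma rescaledH_mul_sub_isBigO {ι : Type*} {F : Filter ι} {p κ a c : ℝ} (hp : 1 < p) (hκ : 0 < κ)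
    (ha : 0 < a) (hc : 0 < c) (μ : ℝ) {σ Φ w D : ι → ℝ} (hσ : Tendsto σ F atTop)
    (hΦ : Tendsto Φ F (𝓝 κ)) (hw : ∀ᶠ q in F, c / σ q ≤ w q ∧ w q ≤ 2)
    (hw1 : (fun q => w q - 1) =O[F] D) (hwp : (fun q => w q ^ p - w q) =O[F] D) :
    (fun q => rescaledH p a μ (σ q) (Φ q * w q) - w q * rescaledH p a μ (σ q) (Φ q)) =O[F]
      fun q => D q * σ q ^ (-a) := by
  have hp' : 0 < p - 1 := by linarith
  set L₁ : ι → ℝ := fun q => Real.log (2 + (Real.exp (σ q / (p - 1)) * (Φ q * w q)) ^ 2) with hL₁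
  set L₂ : ι → ℝ := fun q => Real.log (2 + (Real.exp (σ q / (p - 1)) * Φ q) ^ 2) with hL₂
  have hev : ∀ᶠ q in F, 1 ≤ σ q / (p - 1) ∧ 0 < σ q ∧ 0 < Φ q ∧ 0 < w q ∧ w q ≤ 2 ∧
      σ q / (p - 1) ≤ L₁ q ∧ σ q / (p - 1) ≤ L₂ q := by
    filter_upwards [hσ.eventually (eventually_le_log hp (show 0 < κ / 2 * c by positivity)),
      hσ.eventually (eventually_le_log hp (half_pos hκ)), hσ.eventually_ge_atTop 1,
      hσ.eventually_ge_atTop (p - 1), hΦ.eventually_const_lt (half_lt_self hκ), hw]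
      with q h1 h2 h3 h4 h5 ⟨h6, h7⟩
    have hσ0 : 0 < σ q := by linarith
    have hw0 : 0 < w q := lt_of_lt_of_le (by positivity) h6
    refine ⟨(one_le_div₀ hp').2 h4, hσ0, (half_pos hκ).trans h5, hw0, h7, h1 _ ?_, h2 _ ?_⟩
    · rw [mul_div_assoc]
      exact mul_le_mul h5.le h6 (by positivity) ((half_pos hκ).trans h5).le
    · exact (div_le_self (half_pos hκ).le h3).trans h5.le
  have hσa : ∀ᶠ q in F, (σ q / (p - 1)) ^ (-a) = (1 / (p - 1)) ^ (-a) * σ q ^ (-a) := by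
    filter_upwards [hev] with q hq
    rw [← Real.mul_rpow (by positivity) hq.2.1.le, one_div_mul_eq_div]
  have hA : (fun q => L₂ q ^ (-a)) =O[F] fun q => σ q ^ (-a) := by
    refine IsBigO.of_bound ((1 / (p - 1)) ^ (-a)) ?_
    filter_upwards [hev, hσa] with q ⟨h1, h2, h3, h4, h5, h6, h7⟩ hq
    rw [Real.norm_eq_abs, Real.norm_eq_abs, abs_of_pos (Real.rpow_pos_of_pos h2 _),
      abs_of_nonneg (Real.rpow_nonneg (by linarith) _), ← hq]
    exact Real.rpow_le_rpow_of_nonpos (by linarith) h7 (by linarith)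
  have hB : (fun q => w q ^ p * (L₁ q ^ (-a) - L₂ q ^ (-a))) =O[F]
      fun q => (w q - 1) * σ q ^ (-a) := by
    refine IsBigO.of_bound (a * 2 * 2 ^ p * (1 / (p - 1)) ^ (-a)) ?_
    filter_upwards [hev, hσa] with q ⟨h1, h2, h3, h4, h5, h6, h7⟩ hq
    have hm : 0 < σ q / (p - 1) := by linarith
    have hlog : |L₁ q - L₂ q| ≤ 2 * |Real.log (w q)| := by
      have := abs_log_two_add_sub_le (sq_nonneg (Real.exp (σ q / (p - 1)) * Φ q)) h4
      rwa [← mul_pow, mul_assoc] at this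
    have hpow : (σ q / (p - 1)) ^ (-a - 1) ≤ (σ q / (p - 1)) ^ (-a) :=
      Real.rpow_le_rpow_of_exponent_le h1 (by linarith)
    have hwlog := rpow_mul_abs_log_le hp.le h4 one_le_two h5
    have hwp0 : 0 < w q ^ p := Real.rpow_pos_of_pos h4 p
    rw [norm_mul, norm_mul, Real.norm_eq_abs, Real.norm_eq_abs, Real.norm_eq_abs,
      Real.norm_eq_abs, abs_of_pos hwp0, abs_of_pos (Real.rpow_pos_of_pos h2 _)]
    calc w q ^ p * |L₁ q ^ (-a) - L₂ q ^ (-a)|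
        ≤ w q ^ p * (a * (σ q / (p - 1)) ^ (-a) * (2 * |Real.log (w q)|)) := by
          refine mul_le_mul_of_nonneg_left
            ((abs_rpow_neg_sub_le ha hm h6 h7).trans ?_) hwp0.le
          gcongr
      _ = a * 2 * (σ q / (p - 1)) ^ (-a) * (w q ^ p * |Real.log (w q)|) := by ring
      _ ≤ a * 2 * (σ q / (p - 1)) ^ (-a) * (2 ^ p * |w q - 1|) := by gcongr
      _ = _ := by rw [hq]; ring
  have hΦp : (fun q => μ * Φ q ^ p) =O[F] fun _ => (1 : ℝ) :=
    ((hΦ.rpow_const (Or.inl hκ.ne')).isBigO_one ℝ).const_mul_left μ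
  have hsum := hΦp.mul ((hwp.mul hA).add (hB.trans (hw1.mul (isBigO_refl _ _))))
  simp only [one_mul] at hsum
  refine hsum.congr' ?_ EventuallyEq.rfl
  filter_upwards [hev] with q ⟨h1, h2, h3, h4, h5, h6, h7⟩
  rw [rescaledH_eq hp a μ _ (mul_pos h3 h4), rescaledH_eq hp a μ _ h3,
    Real.mul_rpow h3.le h4.le]
  simp only [hL₁, hL₂]
  ring

lemma Rterm_isBigO {n : ℕ} {p κ : ℝ} (hp : 1 < p) (hκ0 : 0 < κ)
    (hκ : κ ^ (p - 1) = 1 / (p - 1)) {a : ℝ} (ha : 0 < a) (μ : ℝ) {l : ℕ} (hl1 : 1 ≤ l)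
    (hln : l ≤ n) {φ : ℝ → ℝ} {s₀ : ℝ} (hpos : ∀ s, s₀ ≤ s → 0 < φ s)
    (hode : ∀ s, s₀ ≤ s →
      HasDerivAt φ (-(φ s) / (p - 1) + φ s ^ p + rescaledH p a μ s (φ s)) s)
    (hlim : Tendsto φ atTop (𝓝 κ)) :
    (fun q : ℝ × EuclideanSpace ℝ (Fin n) => Rterm n p a μ κ l φ q.2 q.1) =O[atTop ×ˢ ⊤]
      fun q => (‖q.2‖ ^ 2 + 1) / q.1 * q.1 ^ (-(min 1 a)) := by
  have hp' : 0 < p - 1 := by linarith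
  have hl0 : (0 : ℝ) < l := by exact_mod_cast hl1
  set F : Filter (ℝ × EuclideanSpace ℝ (Fin n)) := atTop ×ˢ ⊤ with hF
  have hσ : Tendsto (fun q : ℝ × EuclideanSpace ℝ (Fin n) => q.1) F atTop := tendsto_fst
  have hs1 : ∀ᶠ q : ℝ × EuclideanSpace ℝ (Fin n) in F, 1 ≤ q.1 := hσ.eventually_ge_atTop 1
  set D : ℝ × EuclideanSpace ℝ (Fin n) → ℝ := fun q => (‖q.2‖ ^ 2 + 1) / q.1 with hD
  set T : ℝ × EuclideanSpace ℝ (Fin n) → ℝ := fun q => q.1 ^ (-(min 1 a)) with hT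
  set x : ℝ × EuclideanSpace ℝ (Fin n) → ℝ :=
    fun q => (p - 1) / (4 * p * q.1) * headSq n l q.2 with hx
  set u : ℝ × EuclideanSpace ℝ (Fin n) → ℝ := fun q => (1 + x q) ^ (-(1 / (p - 1))) with hu
  set ε : ℝ × EuclideanSpace ℝ (Fin n) → ℝ := fun q => l / (2 * p * q.1) with hε
  have hx0 : ∀ᶠ q in F, 0 ≤ x q := by
    filter_upwards [hs1] with q hq
    exact mul_nonneg (div_nonneg hp'.le (by positivity)) (headSq_nonneg n l q.2)
  have hu01 : ∀ᶠ q in F, 0 < u q ∧ u q ≤ 1 := by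
    filter_upwards [hx0] with q hq
    exact ⟨by positivity, Real.rpow_le_one_of_one_le_of_nonpos (by linarith)
      (neg_nonpos.2 (by positivity))⟩
  have hε0 : ∀ᶠ q in F, 0 < ε q := by
    filter_upwards [hs1] with q hq
    positivity
  have hε_inv : ∀ q, ε q = l / (2 * p) * q.1⁻¹ := fun q => by
    simp only [hε]; field_simp
  have hεinv : ε =O[F] fun q => q.1⁻¹ :=
    ((isBigO_refl _ _).const_mul_left (l / (2 * p))).congr_left fun q => (hε_inv q).symm
  have hεlim : Tendsto ε F (𝓝 0) := by
    have h := (tendsto_inv_atTop_zero.comp hσ).const_mul ((l : ℝ) / (2 * p))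
    rw [mul_zero] at h
    exact h.congr fun q => (hε_inv q).symm
  have hpowT : ∀ r : ℝ, min 1 a ≤ r →
      (fun q : ℝ × EuclideanSpace ℝ (Fin n) => q.1 ^ (-r)) =O[F] T := by
    intro r hr
    refine IsBigO.of_bound 1 ?_
    filter_upwards [hs1] with q hq
    rw [one_mul, Real.norm_of_nonneg (by positivity), Real.norm_of_nonneg (by positivity)]
    exact Real.rpow_le_rpow_of_exponent_le hq (neg_le_neg hr)
  have hinvT : (fun q : ℝ × EuclideanSpace ℝ (Fin n) => q.1⁻¹) =O[F] T :=
    (hpowT 1 (min_le_left _ _)).congr_left fun q => Real.rpow_neg_one _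
  have hinvD : (fun q : ℝ × EuclideanSpace ℝ (Fin n) => q.1⁻¹) =O[F] D := by
    refine IsBigO.of_bound 1 ?_
    filter_upwards [hs1] with q hq
    rw [one_mul, Real.norm_of_nonneg (by positivity), Real.norm_of_nonneg (by positivity), ← one_div]
    exact div_le_div_of_nonneg_right (by linarith [sq_nonneg ‖q.2‖]) (by linarith)
  have hεD := hεinv.trans hinvD
  have hεT := hεinv.trans hinvT
  have hxD : x =O[F] D := by
    refine IsBigO.of_bound ((p - 1) / (4 * p)) ?_
    filter_upwards [hs1, hx0] with q hq hxq
    rw [Real.norm_of_nonneg hxq, Real.norm_of_nonneg (by positivity)]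
    simp only [hx, hD]
    rw [div_mul_div_comm, div_mul_eq_mul_div]
    gcongr
    linarith [headSq_le_norm_sq n l q.2]
  have hxs : (fun q => x q / q.1) =O[F] fun q => D q * T q :=
    (hxD.mul hinvT).congr_left fun q => (div_eq_mul_inv _ _).symm
  have hone : ∀ r : ℝ, 0 ≤ r → (fun q => 1 - u q ^ r) =O[F] D := by
    intro r hr
    refine IsBigO.trans (IsBigO.of_bound (1 / (p - 1) * r) ?_) hxD
    filter_upwards [hx0, hu01] with q hq hq'
    have h := one_sub_mul_le_one_add_rpow_neg (q := 1 / (p - 1) * r) hq (by positivity)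
    have h' : u q ^ r = (1 + x q) ^ (-(1 / (p - 1) * r)) := by
      rw [hu, ← Real.rpow_mul (by positivity), neg_mul]
    rw [Real.norm_of_nonneg hq,
      Real.norm_of_nonneg (sub_nonneg.2 (Real.rpow_le_one hq'.1.le hq'.2 hr)), h']
    linarith
  have hupow : ∀ r : ℝ, 0 ≤ r → (fun q => u q ^ r) =O[F] fun _ => (1 : ℝ) := by
    intro r hr
    refine IsBigO.of_bound 1 ?_
    filter_upwards [hu01] with q hq
    rw [Real.norm_of_nonneg (Real.rpow_nonneg hq.1.le r), norm_one, one_mul]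
    exact Real.rpow_le_one hq.1.le hq.2 hr
  have hwpow : ∀ r : ℝ, 0 ≤ r → (fun q => (u q + ε q) ^ r - 1) =O[F] D := fun r hr =>
    add_rpow_sub_one_isBigO hr hu01 hε0 hεlim hεD (hone r hr)
  have hw1 : (fun q => u q + ε q - 1) =O[F] D :=
    (hwpow 1 zero_le_one).congr_left fun q => by rw [Real.rpow_one]
  have hwpw : (fun q => (u q + ε q) ^ p - (u q + ε q)) =O[F] D :=
    ((hwpow p (by linarith)).sub hw1).congr_left fun q => by ring
  have hΦ : Tendsto (fun q : ℝ × EuclideanSpace ℝ (Fin n) => φ q.1) F (𝓝 κ) := hlim.comp hσ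
  have hΦ1 : (fun q : ℝ × EuclideanSpace ℝ (Fin n) => φ q.1) =O[F] fun _ => (1 : ℝ) :=
    hΦ.isBigO_one ℝ
  have hrate : (fun q : ℝ × EuclideanSpace ℝ (Fin n) => φ q.1 ^ (p - 1) - 1 / (p - 1)) =O[F] T := by
    have h1 := (Real.differentiableAt_rpow_const_of_ne (p - 1) hκ0.ne').isBigO_sub.comp_tendsto hlim
    have h2 := h1.trans (sub_kappa_isBigO hp hκ0 hκ ha hode hlim (rescaledH_isBigO hp hκ0 ha μ hlim))
    simp only [Function.comp_def, hκ] at h2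
    exact (h2.comp_tendsto hσ).trans (hpowT a (min_le_right _ _))
  have hprofile : (fun q => φ q.1 * (-(1 / (p - 1) * u q ^ p * (x q / q.1)) + ε q / q.1 +
      1 / (p - 1) * (1 + x q) ^ (-(1 / (p - 1)) - 1 - 1) * (x q / q.1))) =O[F]
      fun q => D q * T q := by
    have h1 : (fun q => 1 / (p - 1) * u q ^ p * (x q / q.1)) =O[F] fun q => D q * T q := by
      simpa using ((hupow p (by linarith)).const_mul_left (1 / (p - 1))).mul hxs
    have h2 : (fun q => ε q / q.1) =O[F] fun q => D q * T q :=
      (hεD.mul hinvT).congr_left fun q => (div_eq_mul_inv _ _).symm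
    have h3 : (fun q => (1 + x q) ^ (-(1 / (p - 1)) - 1 - 1)) =O[F] fun _ => (1 : ℝ) := by
      refine IsBigO.of_bound 1 ?_
      filter_upwards [hx0] with q hq
      rw [Real.norm_of_nonneg (by positivity), norm_one, one_mul]
      have : 0 < 1 / (p - 1) := by positivity
      exact Real.rpow_le_one_of_one_le_of_nonpos (by linarith) (by linarith)
    have h4 : (fun q => 1 / (p - 1) * (1 + x q) ^ (-(1 / (p - 1)) - 1 - 1) * (x q / q.1)) =O[F]
        fun q => D q * T q := by
      simpa using (h3.const_mul_left (1 / (p - 1))).mul hxs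
    simpa using hΦ1.mul ((h1.neg_left.add h2).add h4)
  have htaylor : (fun q => φ q.1 * (1 / (p - 1)) *
      ((u q + ε q) ^ p - u q ^ p - p * ε q * u q ^ (p - 1))) =O[F] fun q => D q * T q := by
    have h1 : (fun q => (u q + ε q) ^ (p - 1) - u q ^ (p - 1)) =O[F] D :=
      ((hwpow (p - 1) hp'.le).add (hone (p - 1) hp'.le)).congr_left fun q => by ring
    have h2 : (fun q => (u q + ε q) ^ p - u q ^ p - p * ε q * u q ^ (p - 1)) =O[F]
        fun q => D q * T q := by
      refine IsBigO.trans (IsBigO.of_bound 1 ?_) (h1.mul (hεT.const_mul_left p))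
      filter_upwards [hu01, hε0] with q hq hq'
      rw [one_mul, Real.norm_eq_abs, Real.norm_eq_abs, mul_comm ((u q + ε q) ^ (p - 1) - _)]
      exact (abs_rpow_add_sub_le hp hq.1 hq').trans (le_abs_self _)
    have h3 : (fun q : ℝ × EuclideanSpace ℝ (Fin n) => φ q.1 * (1 / (p - 1))) =O[F]
        fun _ => (1 : ℝ) := by
      simpa [mul_comm] using hΦ1.const_mul_left (1 / (p - 1))
    simpa using h3.mul h2
  have hcross : (fun q => φ q.1 * ε q *
      (1 / (p - 1) * p * u q ^ (p - 1) - 1 / (p - 1) - u q ^ p)) =O[F] fun q => D q * T q := by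
    have h1 : (fun q => 1 / (p - 1) * p * u q ^ (p - 1) - 1 / (p - 1) - u q ^ p) =O[F] D := by
      refine ((hone p (by linarith)).sub
        ((hone (p - 1) hp'.le).const_mul_left (1 / (p - 1) * p))).congr_left fun q => ?_
      have : 1 / (p - 1) * p = 1 / (p - 1) + 1 := by field_simp; ring
      linear_combination -this
    refine ((hΦ1.mul hεT).mul h1).congr_right fun q => by ring
  have hconst : (fun q => φ q.1 * (φ q.1 ^ (p - 1) - 1 / (p - 1)) *
      ((u q + ε q) ^ p - (u q + ε q))) =O[F] fun q => D q * T q :=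
    ((hΦ1.mul hrate).mul hwpw).congr_right fun q => by ring
  have hforce : (fun q => rescaledH p a μ q.1 (φ q.1 * (u q + ε q)) -
      (u q + ε q) * rescaledH p a μ q.1 (φ q.1)) =O[F] fun q => D q * T q := by
    refine (rescaledH_mul_sub_isBigO hp hκ0 ha (c := l / (2 * p)) (by positivity) μ hσ hΦ ?_ hw1
      hwpw).trans ((isBigO_refl D F).mul (hpowT a (min_le_right _ _)))
    filter_upwards [hu01, hεlim.eventually_lt_const one_pos] with q hq hq'
    refine ⟨?_, by linarith⟩
    rw [div_eq_mul_inv _ q.1, ← hε_inv]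
    linarith
  refine ((((hprofile.add htaylor).add hcross).add hconst).add hforce).congr' ?_ EventuallyEq.rfl
  filter_upwards [hs1, hσ.eventually_ge_atTop s₀] with q hq hq'
  exact (Rterm_eq hp hκ0.ne' a μ hln (by linarith) (hpos _ hq') (hode _ hq') q.2 rfl rfl rfl).symm

/-- Estimate of the error term `R(y,s)`. -/
theorem stmt15 (n : ℕ) (hn : 1 ≤ n) (p : ℝ) (hp : 1 < p)
    (hpS : 3 ≤ n → p < ((n : ℝ) + 2) / ((n : ℝ) - 2)) (a : ℝ) (ha : 0 < a) (μ : ℝ)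
    (κ : ℝ) (hκ : κ = (p - 1) ^ (-(1 / (p - 1))))
    (s₀ : ℝ) (φ : ℝ → ℝ) (hpos : ∀ s, s₀ ≤ s → 0 < φ s)
    (hode : ∀ s, s₀ ≤ s → HasDerivAt φ
      (-(φ s) / (p - 1) + φ s ^ p +
        Real.exp (-p * s / (p - 1)) * hfun p a μ (Real.exp (s / (p - 1)) * φ s)) s)
    (hlim : Tendsto φ atTop (nhds κ))
    (l : ℕ) (hl1 : 1 ≤ l) (hln : l ≤ n) :
    ∃ C > (0:ℝ), ∃ s₁ : ℝ, s₀ ≤ s₁ ∧ ∀ s, s₁ ≤ s → ∀ y : EuclideanSpace ℝ (Fin n),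
      |Rterm n p a μ κ l φ y s| ≤ C * (‖y‖ ^ 2 + 1) / s ^ (min 1 a + 1) := by
  have hκ0 : 0 < κ := hκ ▸ Real.rpow_pos_of_pos (by linarith) _
  obtain ⟨C, hC, hbound⟩ := (Rterm_isBigO hp hκ0 (kappa_rpow_sub_one hp hκ) ha μ hl1 hln hpos
    hode hlim).exists_pos
  obtain ⟨S, hS⟩ := eventually_atTop.1 (mem_prod_top.1 hbound.bound)
  refine ⟨C, hC, max s₀ (max S 1), le_max_left _ _, fun s hs y => ?_⟩
  have hs1 : 1 ≤ s := (le_max_right _ _).trans ((le_max_right _ _).trans hs)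
  have hs0 : 0 < s := by linarith
  have h := hS s ((le_max_left _ _).trans ((le_max_right _ _).trans hs)) y
  simp only [Set.mem_ofPred_eq, Real.norm_eq_abs] at h
  rw [abs_of_nonneg (by positivity : 0 ≤ (‖y‖ ^ 2 + 1) / s * s ^ (-(min 1 a)))] at h
  refine h.trans_eq ?_
  rw [Real.rpow_add hs0, Real.rpow_one, Real.rpow_neg hs0.le]
  field_simp
end
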